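/- Suppose G is a Finsler-type energy on ℝ^n and Φ defines a regular bounded domain Ω with constant δ₀. Let x be a non-constant V⁻-critical curve for J on Mf. Then exactly one of the following holds. Either there exists s̄ ∈ (0,1) such that x restricted to [0,s̄] is an orthogonal–tangent Finsler geodesic chord: x(s) ∈ Ω for s ∈ (0,s̄), x(s̄) ∈ ∂Ω, x satisfies the free Euler–Lagrange equation (d/ds) d_vG(x,ẋ) = d_qG(x,ẋ) on [0,s̄], d_vG(x(0),ẋ(0))[w] = 0 for every w with ⟨∇Φ(x(0)),w⟩ = 0, and ⟨∇Φ(x(s̄)),ẋ(s̄)⟩ = 0; or x is an orthogonal Finsler geodesic chord: x(s) ∈ Ω for every s ∈ (0,1), x satisfies the free Euler–Lagrange equation on [0,1], and d_vG(x(i),ẋ(i))[w] = 0 for i = 0,1 and every w with ⟨∇Φ(x(i)),w⟩ = 0. -/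

import Mathlib

open MeasureTheory Set Filter RealInnerProductSpace

noncomputable section

/-- Euclidean space `ℝ^n`. -/
abbrev Evec (n : ℕ) := EuclideanSpace ℝ (Fin n)

/-- An `H¹` curve on `[a,b]`: an absolutely continuous curve whose a.e. derivative is
square-integrable, encoded by a choice of (integrable, square-integrable) derivative
together with the fundamental theorem of calculus identity. -/
structure H1Curve (n : ℕ) (a b : ℝ) where
  toFun : ℝ → Evec n
  deriv : ℝ → Evec n
  deriv_integrable : IntegrableOn deriv (Icc a b)
  deriv_sq_integrable : IntegrableOn (fun s => ‖deriv s‖ ^ 2) (Icc a b)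
  eq_add_integral : ∀ t ∈ Icc a b, toFun t = toFun a + ∫ s in a..t, deriv s

/-- The partial differential `d_qG(q,v)` of `G` in the first variable. -/
def dqCLM {n : ℕ} (G : Evec n → Evec n → ℝ) (q v : Evec n) : Evec n →L[ℝ] ℝ :=
  fderiv ℝ (fun z => G z v) q

/-- The partial differential `d_vG(q,v)` of `G` in the second variable. -/
def dvCLM {n : ℕ} (G : Evec n → Evec n → ℝ) (q v : Evec n) : Evec n →L[ℝ] ℝ :=
  fderiv ℝ (fun w => G q w) v

/-- A Finsler-type energy on `ℝ^n` with constants `ℓ ≥ 1` and `α > 0`. -/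
structure IsFinslerEnergy (n : ℕ) (G : Evec n → Evec n → ℝ) (ℓ α : ℝ) : Prop where
  continuous : Continuous fun p : Evec n × Evec n => G p.1 p.2
  smooth : ContDiffOn ℝ 2 (fun p : Evec n × Evec n => G p.1 p.2) {p | p.2 ≠ 0}
  homog : ∀ (q v : Evec n) (lam : ℝ), 0 < lam → G q (lam • v) = lam ^ 2 * G q v
  one_le_ell : 1 ≤ ℓ
  alpha_pos : 0 < α
  lower : ∀ q v, (1 / ℓ) * ‖v‖ ^ 2 ≤ G q v
  upper : ∀ q v, G q v ≤ ℓ * ‖v‖ ^ 2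
  dq_bound : ∀ q v, ‖dqCLM G q v‖ ≤ ℓ * (1 + ‖v‖ ^ 2)
  dv_bound : ∀ q v, ‖dvCLM G q v‖ ≤ ℓ * (1 + ‖v‖)
  vv_convex : ∀ (q v : Evec n), v ≠ 0 → ∀ w : Evec n,
    α * ‖w‖ ^ 2 ≤ fderiv ℝ (fun u => dvCLM G q u w) v w

/-- `Φ` defines a regular bounded domain `Ω = Φ⁻¹((−∞,0))` with constant `δ₀`. -/
structure IsRegularDomain (n : ℕ) (Φ : Evec n → ℝ) (δ₀ : ℝ) : Prop where
  smooth : ContDiff ℝ 2 Φ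
  nonempty : (Φ ⁻¹' Iio 0).Nonempty
  bounded : Bornology.IsBounded (Φ ⁻¹' Iio 0)
  boundary_eq : frontier (Φ ⁻¹' Iio 0) = Φ ⁻¹' {0}
  delta0_pos : 0 < δ₀
  grad_ne_zero : ∀ q : Evec n, |Φ q| ≤ δ₀ → gradient Φ q ≠ 0
  sublevel_compact : ∀ δ ∈ Icc (0:ℝ) δ₀, IsCompact (Φ ⁻¹' Iic δ)

/-- Membership in `Mf`: curves in `Ω̄` with endpoints on `∂Ω`. -/
def MemMf {n : ℕ} (Φ : Evec n → ℝ) (x : H1Curve n 0 1) : Prop :=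
  (∀ s ∈ Icc (0:ℝ) 1, Φ (x.toFun s) ≤ 0) ∧ Φ (x.toFun 0) = 0 ∧ Φ (x.toFun 1) = 0

/-- Membership in `V⁻(x,Mf)`. -/
def MemVminus {n : ℕ} (Φ : Evec n → ℝ) (x ξ : H1Curve n 0 1) : Prop :=
  ⟪gradient Φ (x.toFun 0), ξ.toFun 0⟫ = 0 ∧
  ⟪gradient Φ (x.toFun 1), ξ.toFun 1⟫ = 0 ∧
  ∀ s ∈ Ioo (0:ℝ) 1, Φ (x.toFun s) = 0 → ⟪gradient Φ (x.toFun s), ξ.toFun s⟫ ≤ 0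

/-- Membership in `W⁻(x,Mf)`: as `V⁻` but with strict inequality at interior touching points. -/
def MemWminus {n : ℕ} (Φ : Evec n → ℝ) (x ξ : H1Curve n 0 1) : Prop :=
  MemVminus Φ x ξ ∧
  ∀ s ∈ Ioo (0:ℝ) 1, Φ (x.toFun s) = 0 → ⟪gradient Φ (x.toFun s), ξ.toFun s⟫ < 0

/-- The energy functional `J(x) = (1/2)∫₀¹ G(x,ẋ)`. -/
def energy {n : ℕ} (G : Evec n → Evec n → ℝ) (x : H1Curve n 0 1) : ℝ :=
  (1 / 2) * ∫ s in (0:ℝ)..1, G (x.toFun s) (x.deriv s)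

/-- The differential `dJ(x)[ξ]`. -/
def dJ {n : ℕ} (G : Evec n → Evec n → ℝ) (x ξ : H1Curve n 0 1) : ℝ :=
  (1 / 2) * ∫ s in (0:ℝ)..1,
    (dqCLM G (x.toFun s) (x.deriv s) (ξ.toFun s) + dvCLM G (x.toFun s) (x.deriv s) (ξ.deriv s))

/-- `x` is a `V⁻`-critical curve for `J` on `Mf`. -/
def IsVCritical {n : ℕ} (G : Evec n → Evec n → ℝ) (Φ : Evec n → ℝ) (x : H1Curve n 0 1) : Prop :=
  MemMf Φ x ∧ ∀ ξ : H1Curve n 0 1, MemVminus Φ x ξ → 0 ≤ dJ G x ξ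

/-- The norm `‖ξ‖_*`. -/
def starNorm {n : ℕ} (ξ : H1Curve n 0 1) : ℝ :=
  max ‖ξ.toFun 0‖ ‖ξ.toFun 1‖ + Real.sqrt (∫ s in (0:ℝ)..1, ‖ξ.deriv s‖ ^ 2)

/-- The distance `dist_*`. -/
def starDist {n : ℕ} (x y : H1Curve n 0 1) : ℝ :=
  max ‖x.toFun 0 - y.toFun 0‖ ‖x.toFun 1 - y.toFun 1‖ +
    Real.sqrt (∫ s in (0:ℝ)..1, ‖x.deriv s - y.deriv s‖ ^ 2)

/-- The penalization function `χ_δ`. -/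
def chi (δ t : ℝ) : ℝ := if t ≤ 0 then 0 else t ^ 2 / (δ - t) ^ 2

/-- Membership in `C_δ = C([a,b],p,q,Ω_δ)`. -/
def MemC {n : ℕ} (Φ : Evec n → ℝ) (δ a b : ℝ) (p q : Evec n) (γ : H1Curve n a b) : Prop :=
  (∀ s ∈ Icc a b, Φ (γ.toFun s) < δ) ∧ γ.toFun a = p ∧ γ.toFun b = q

/-- The penalized functional `J_δ`. -/
def Jpen {n : ℕ} (G : Evec n → Evec n → ℝ) (Φ : Evec n → ℝ) (δ a b : ℝ)
    (γ : H1Curve n a b) : ℝ :=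
  (1 / 2) * (∫ s in a..b, G (γ.toFun s) (γ.deriv s)) + ∫ s in a..b, chi δ (Φ (γ.toFun s))

/-- `y` represents the backward parametrization `ℛx` of `x` (on `[0,1]`). -/
def RevRep {n : ℕ} (x y : H1Curve n 0 1) : Prop :=
  (∀ s, y.toFun s = x.toFun (1 - s)) ∧ (∀ s, y.deriv s = -x.deriv (1 - s))


open Topology

section FinslerFacts

variable {n : ℕ} {G : Evec n → Evec n → ℝ} {ℓ α : ℝ}

theorem IsFinslerEnergy.ell_pos (hG : IsFinslerEnergy n G ℓ α) : 0 < ℓ :=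
  lt_of_lt_of_le one_pos hG.one_le_ell

theorem IsFinslerEnergy.G_zero (hG : IsFinslerEnergy n G ℓ α) (q : Evec n) : G q 0 = 0 := by
  have h1 := hG.lower q 0
  have h2 := hG.upper q 0
  simp at h1 h2
  linarith

theorem IsFinslerEnergy.G_nonneg (hG : IsFinslerEnergy n G ℓ α) (q v : Evec n) : 0 ≤ G q v := by
  have h1 := hG.lower q v
  have := hG.ell_pos
  have : 0 ≤ (1 / ℓ) * ‖v‖ ^ 2 := by positivity
  linarith

theorem IsFinslerEnergy.isOpen_ne : IsOpen {p : Evec n × Evec n | p.2 ≠ 0} :=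
  isOpen_ne_fun continuous_snd continuous_const

theorem IsFinslerEnergy.contDiffAt (hG : IsFinslerEnergy n G ℓ α) (q : Evec n) {v : Evec n}
    (hv : v ≠ 0) : ContDiffAt ℝ 2 (fun p : Evec n × Evec n => G p.1 p.2) (q, v) :=
  hG.smooth.contDiffAt (IsFinslerEnergy.isOpen_ne.mem_nhds hv)

theorem IsFinslerEnergy.hasFDerivAt (hG : IsFinslerEnergy n G ℓ α) (q : Evec n) {v : Evec n}
    (hv : v ≠ 0) : HasFDerivAt (fun p : Evec n × Evec n => G p.1 p.2)
      (fderiv ℝ (fun p : Evec n × Evec n => G p.1 p.2) (q, v)) (q, v) :=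
  ((hG.contDiffAt q hv).differentiableAt (by norm_num)).hasFDerivAt

theorem IsFinslerEnergy.hasFDerivAt_dv_ne (hG : IsFinslerEnergy n G ℓ α) (q : Evec n) {v : Evec n}
    (hv : v ≠ 0) : HasFDerivAt (fun w => G q w)
      ((fderiv ℝ (fun p : Evec n × Evec n => G p.1 p.2) (q, v)).comp
        (ContinuousLinearMap.inr ℝ (Evec n) (Evec n))) v :=
  (hG.hasFDerivAt q hv).comp (f := fun w => (q, w)) v (hasFDerivAt_prodMk_right q v)

theorem IsFinslerEnergy.hasFDerivAt_dq_ne (hG : IsFinslerEnergy n G ℓ α) (q : Evec n) {v : Evec n}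
    (hv : v ≠ 0) : HasFDerivAt (fun z => G z v)
      ((fderiv ℝ (fun p : Evec n × Evec n => G p.1 p.2) (q, v)).comp
        (ContinuousLinearMap.inl ℝ (Evec n) (Evec n))) q :=
  (hG.hasFDerivAt q hv).comp (f := fun z => (z, v)) q (hasFDerivAt_prodMk_left q v)

theorem IsFinslerEnergy.hasFDerivAt_dq (hG : IsFinslerEnergy n G ℓ α) (q v : Evec n) :
    HasFDerivAt (fun z => G z v) (dqCLM G q v) q := by
  by_cases hv : v = 0
  · subst hv
    have : (fun z => G z 0) = fun _ => (0 : ℝ) := by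
      ext z
      exact hG.G_zero z
    unfold dqCLM
    rw [this]
    simpa using hasFDerivAt_const (0 : ℝ) q
  · exact (hG.hasFDerivAt_dq_ne q hv).differentiableAt.hasFDerivAt

theorem IsFinslerEnergy.hasFDerivAt_dv_zero (hG : IsFinslerEnergy n G ℓ α) (q : Evec n) :
    HasFDerivAt (fun w => G q w) (0 : Evec n →L[ℝ] ℝ) 0 := by
  rw [hasFDerivAt_iff_isLittleO_nhds_zero]
  have h1 : (fun h : Evec n => G q (0 + h) - G q 0 - (0 : Evec n →L[ℝ] ℝ) h) =O[𝓝 0]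
      fun h : Evec n => ‖h‖ ^ 2 := by
    refine Asymptotics.IsBigO.of_bound ℓ (Eventually.of_forall fun h => ?_)
    simp only [zero_add, hG.G_zero, zero_apply, sub_zero, Real.norm_eq_abs]
    rw [abs_of_nonneg (hG.G_nonneg _ _), abs_of_nonneg (by positivity)]
    exact hG.upper q h
  refine h1.trans_isLittleO ?_
  exact (Asymptotics.isLittleO_norm_pow_id one_lt_two)

theorem IsFinslerEnergy.dv_zero (hG : IsFinslerEnergy n G ℓ α) (q : Evec n) :
    dvCLM G q 0 = 0 := (hG.hasFDerivAt_dv_zero q).fderiv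

theorem IsFinslerEnergy.dq_zero (hG : IsFinslerEnergy n G ℓ α) (q : Evec n) :
    dqCLM G q 0 = 0 := by
  unfold dqCLM
  have : (fun z => G z 0) = fun _ => (0 : ℝ) := by
    ext z
    exact hG.G_zero z
  rw [this]
  simp

theorem IsFinslerEnergy.hasFDerivAt_dv (hG : IsFinslerEnergy n G ℓ α) (q v : Evec n) :
    HasFDerivAt (fun w => G q w) (dvCLM G q v) v := by
  by_cases hv : v = 0
  · subst hv
    rw [hG.dv_zero]
    exact hG.hasFDerivAt_dv_zero q
  · exact (hG.hasFDerivAt_dv_ne q hv).differentiableAt.hasFDerivAt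

theorem IsFinslerEnergy.dv_smul (hG : IsFinslerEnergy n G ℓ α) (q v : Evec n) {c : ℝ}
    (hc : 0 < c) : dvCLM G q (c • v) = c • dvCLM G q v := by
  have h1 : HasFDerivAt (fun w => G q (c • w)) (c • dvCLM G q (c • v)) v := by
    have h := (hG.hasFDerivAt_dv q (c • v)).comp (f := fun w : Evec n => c • w) v
      ((hasFDerivAt_id v).const_smul c)
    refine h.congr_fderiv ?_
    ext w
    simp
  have h2 : HasFDerivAt (fun w => G q (c • w)) (c ^ 2 • dvCLM G q v) v := by
    have : (fun w => G q (c • w)) = fun w => c ^ 2 • G q w := by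
      ext w
      exact hG.homog q w c hc
    rw [this]
    exact (hG.hasFDerivAt_dv q v).fun_const_smul (c ^ 2)
  have h3 := h1.unique h2
  rw [sq, mul_smul] at h3
  exact smul_right_injective _ hc.ne' h3

theorem IsFinslerEnergy.dq_smul (hG : IsFinslerEnergy n G ℓ α) (q v : Evec n) {c : ℝ}
    (hc : 0 < c) : dqCLM G q (c • v) = c ^ 2 • dqCLM G q v := by
  have h2 : HasFDerivAt (fun z => G z (c • v)) (c ^ 2 • dqCLM G q v) q := by
    have : (fun z => G z (c • v)) = fun z => c ^ 2 • G z v := by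
      ext w
      exact hG.homog w v c hc
    rw [this]
    exact (hG.hasFDerivAt_dq q v).fun_const_smul (c ^ 2)
  exact h2.fderiv

theorem IsFinslerEnergy.dv_le (hG : IsFinslerEnergy n G ℓ α) (q v : Evec n) :
    ‖dvCLM G q v‖ ≤ ℓ * ‖v‖ := by
  have h : ∀ c : ℝ, 0 < c → ‖dvCLM G q v‖ ≤ ℓ * (c + ‖v‖) := by
    intro c hc
    have h1 := hG.dv_bound q (c⁻¹ • v)
    rw [hG.dv_smul q v (inv_pos.2 hc), norm_smul, norm_smul, Real.norm_of_nonneg (by positivity)]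
      at h1
    have h2 := mul_le_mul_of_nonneg_left h1 hc.le
    have e1 : c * (c⁻¹ * ‖dvCLM G q v‖) = ‖dvCLM G q v‖ := by field_simp
    have e2 : c * (ℓ * (1 + c⁻¹ * ‖v‖)) = ℓ * (c + ‖v‖) := by field_simp
    linarith
  refine le_of_forall_pos_le_add fun ε hε => ?_
  have := h (ε / ℓ) (div_pos hε hG.ell_pos)
  have e : ℓ * (ε / ℓ + ‖v‖) = ℓ * ‖v‖ + ε := by
    have := hG.ell_pos.ne'
    field_simp
    ring
  linarith

theorem IsFinslerEnergy.dq_le (hG : IsFinslerEnergy n G ℓ α) (q v : Evec n) :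
    ‖dqCLM G q v‖ ≤ ℓ * ‖v‖ ^ 2 := by
  have h : ∀ c : ℝ, 0 < c → ‖dqCLM G q v‖ ≤ ℓ * (c ^ 2 + ‖v‖ ^ 2) := by
    intro c hc
    have h1 := hG.dq_bound q (c⁻¹ • v)
    rw [hG.dq_smul q v (inv_pos.2 hc), norm_smul, norm_smul, Real.norm_of_nonneg (by positivity),
      Real.norm_of_nonneg (by positivity)] at h1
    have h2 := mul_le_mul_of_nonneg_left h1 (sq_nonneg c)
    have e1 : c ^ 2 * (c⁻¹ ^ 2 * ‖dqCLM G q v‖) = ‖dqCLM G q v‖ := by field_simp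
    have e2 : c ^ 2 * (ℓ * (1 + (c⁻¹ * ‖v‖) ^ 2)) = ℓ * (c ^ 2 + ‖v‖ ^ 2) := by field_simp
    linarith
  refine le_of_forall_pos_le_add fun ε hε => ?_
  have := h (Real.sqrt (ε / ℓ)) (Real.sqrt_pos.2 (div_pos hε hG.ell_pos))
  rw [Real.sq_sqrt (div_pos hε hG.ell_pos).le] at this
  have e : ℓ * (ε / ℓ + ‖v‖ ^ 2) = ℓ * ‖v‖ ^ 2 + ε := by
    have := hG.ell_pos.ne'
    field_simp
    ring
  linarith

theorem IsFinslerEnergy.continuous_dv (hG : IsFinslerEnergy n G ℓ α) :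
    Continuous fun p : Evec n × Evec n => dvCLM G p.1 p.2 := by
  rw [continuous_iff_continuousAt]
  rintro ⟨q, v⟩
  by_cases hv : v = 0
  · subst hv
    unfold ContinuousAt
    simp only [hG.dv_zero]
    apply squeeze_zero_norm (a := fun p : Evec n × Evec n => ℓ * ‖p.2‖) (fun p => hG.dv_le _ _)
    have : Continuous fun p : Evec n × Evec n => ℓ * ‖p.2‖ := by fun_prop
    simpa using this.tendsto (q, (0 : Evec n))
  · have h1 : ContinuousAt (fderiv ℝ (fun p : Evec n × Evec n => G p.1 p.2)) (q, v) :=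
      (hG.contDiffAt q hv).continuousAt_fderiv (by norm_num)
    have h2 : ContinuousAt (fun p => (fderiv ℝ (fun p : Evec n × Evec n => G p.1 p.2) p).comp
        (ContinuousLinearMap.inr ℝ (Evec n) (Evec n))) (q, v) :=
      h1.clm_comp continuousAt_const
    refine h2.congr ?_
    filter_upwards [IsFinslerEnergy.isOpen_ne.mem_nhds (show (q, v) ∈ _ from hv)] with p hp
    exact (hG.hasFDerivAt_dv_ne p.1 hp).fderiv.symm

theorem IsFinslerEnergy.continuous_dq (hG : IsFinslerEnergy n G ℓ α) :
    Continuous fun p : Evec n × Evec n => dqCLM G p.1 p.2 := by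
  rw [continuous_iff_continuousAt]
  rintro ⟨q, v⟩
  by_cases hv : v = 0
  · subst hv
    unfold ContinuousAt
    simp only [hG.dq_zero]
    apply squeeze_zero_norm (a := fun p : Evec n × Evec n => ℓ * ‖p.2‖ ^ 2)
      (fun p => hG.dq_le _ _)
    have : Continuous fun p : Evec n × Evec n => ℓ * ‖p.2‖ ^ 2 := by fun_prop
    simpa using this.tendsto (q, (0 : Evec n))
  · have h1 : ContinuousAt (fderiv ℝ (fun p : Evec n × Evec n => G p.1 p.2)) (q, v) :=
      (hG.contDiffAt q hv).continuousAt_fderiv (by norm_num)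
    have h2 : ContinuousAt (fun p => (fderiv ℝ (fun p : Evec n × Evec n => G p.1 p.2) p).comp
        (ContinuousLinearMap.inl ℝ (Evec n) (Evec n))) (q, v) :=
      h1.clm_comp continuousAt_const
    refine h2.congr ?_
    filter_upwards [IsFinslerEnergy.isOpen_ne.mem_nhds (show (q, v) ∈ _ from hv)] with p hp
    exact (hG.hasFDerivAt_dq_ne p.1 hp).fderiv.symm

theorem IsFinslerEnergy.differentiableAt_dv (hG : IsFinslerEnergy n G ℓ α) (q : Evec n)
    {v : Evec n} (hv : v ≠ 0) (w : Evec n) : DifferentiableAt ℝ (fun u => dvCLM G q u w) v := by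
  have h1 : DifferentiableAt ℝ (fderiv ℝ (fun p : Evec n × Evec n => G p.1 p.2)) (q, v) :=
    ((hG.contDiffAt q hv).fderiv_right (m := 1) (by norm_num)).differentiableAt (by norm_num)
  have h2 : DifferentiableAt ℝ
      (fun u => fderiv ℝ (fun p : Evec n × Evec n => G p.1 p.2) (q, u) (0, w)) v := by
    have h3 : DifferentiableAt ℝ
      (fun u => fderiv ℝ (fun p : Evec n × Evec n => G p.1 p.2) (q, u)) v :=
      h1.comp (f := fun u => (q, u)) v (hasFDerivAt_prodMk_right q v).differentiableAt
    exact h3.clm_apply (differentiableAt_const _)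
  refine h2.congr_of_eventuallyEq ?_
  filter_upwards [_root_.isOpen_ne.mem_nhds hv] with u hu
  have := (hG.hasFDerivAt_dv_ne q hu).fderiv
  unfold dvCLM
  rw [this]
  simp

theorem IsFinslerEnergy.dv_mono (hG : IsFinslerEnergy n G ℓ α) (q u w : Evec n) :
    α * ‖u - w‖ ^ 2 ≤ (dvCLM G q u - dvCLM G q w) (u - w) := by
  by_cases huw : u = w
  · subst huw
    simp
  have hd : u - w ≠ 0 := sub_ne_zero.2 huw
  set d := u - w with hd_def
  set g : ℝ → ℝ := fun t => dvCLM G q (w + t • d) d - α * ‖d‖ ^ 2 * t with hg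
  have hgc : Continuous g := by
    have h1 : Continuous fun t : ℝ => dvCLM G q (w + t • d) :=
      hG.continuous_dv.comp (f := fun t : ℝ => (q, w + t • d)) (by fun_prop)
    have h2 : Continuous fun t : ℝ => dvCLM G q (w + t • d) d := h1.clm_apply continuous_const
    fun_prop
  have hgd : ∀ t : ℝ, w + t • d ≠ 0 → 0 ≤ deriv g t := by
    intro t ht
    have h1 : HasFDerivAt (fun u => dvCLM G q u d) (fderiv ℝ (fun u => dvCLM G q u d) (w + t • d))
        (w + t • d) := (hG.differentiableAt_dv q ht d).hasFDerivAt
    have h2 : HasDerivAt (fun t : ℝ => w + t • d) d t := by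
      simpa using ((hasDerivAt_id t).smul_const d).const_add w
    have h3 := h1.comp_hasDerivAt t h2
    have h4 : HasDerivAt g (fderiv ℝ (fun u => dvCLM G q u d) (w + t • d) d - α * ‖d‖ ^ 2) t := by
      have := h3.fun_sub ((hasDerivAt_id' t).const_mul (α * ‖d‖ ^ 2))
      rw [mul_one] at this
      exact this
    rw [h4.deriv]
    have := hG.vv_convex q _ ht d
    linarith
  have hgdiff : ∀ t : ℝ, w + t • d ≠ 0 → DifferentiableAt ℝ g t := by
    intro t ht
    have h1 := hG.differentiableAt_dv q ht d
    have h2 : DifferentiableAt ℝ (fun t : ℝ => w + t • d) t := by fun_prop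
    have h3 : DifferentiableAt ℝ (fun t : ℝ => dvCLM G q (w + t • d) d) t :=
      DifferentiableAt.comp (g := fun u => dvCLM G q u d) t h1 h2
    exact h3.fun_sub (by fun_prop)
  have hmono : ∀ p r : ℝ, p ≤ r → (∀ t ∈ Ioo p r, w + t • d ≠ 0) → g p ≤ g r := by
    intro p r hpr h
    refine monotoneOn_of_deriv_nonneg (convex_Icc p r) hgc.continuousOn ?_ ?_
      (left_mem_Icc.2 hpr) (right_mem_Icc.2 hpr) hpr
    · intro t ht
      rw [interior_Icc] at ht
      exact (hgdiff t (h t ht)).differentiableWithinAt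
    · intro t ht
      rw [interior_Icc] at ht
      exact hgd t (h t ht)
  have h01 : g 0 ≤ g 1 := by
    by_cases hex : ∃ t ∈ Ioo (0:ℝ) 1, w + t • d = 0
    · obtain ⟨t0, ht0, h0⟩ := hex
      have huniq : ∀ t, w + t • d = 0 → t = t0 := by
        intro t ht
        have : (t - t0) • d = 0 := by
          rw [sub_smul]
          have := ht.trans h0.symm
          simpa [sub_eq_zero] using this
        rcases smul_eq_zero.1 this with h | h
        · linarith
        · exact absurd h hd
      have h1 := hmono 0 t0 ht0.1.le (fun t ht h => by
        have := huniq t h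
        exact absurd this ht.2.ne)
      have h2 := hmono t0 1 ht0.2.le (fun t ht h => by
        have := huniq t h
        exact absurd this ht.1.ne')
      exact h1.trans h2
    · push Not at hex
      exact hmono 0 1 zero_le_one hex
  have e1 : w + (1:ℝ) • d = u := by simp [d]
  simp only [hg, e1, zero_smul, add_zero, mul_zero, mul_one] at h01
  rw [sub_apply]
  linarith

theorem IsFinslerEnergy.dv_inj (hG : IsFinslerEnergy n G ℓ α) {q u w : Evec n}
    (h : dvCLM G q u = dvCLM G q w) : u = w := by
  have h1 := hG.dv_mono q u w
  rw [h] at h1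
  simp only [sub_self, zero_apply] at h1
  have h2 : ‖u - w‖ ^ 2 ≤ 0 := by
    by_contra hc
    push Not at hc
    have := mul_pos hG.alpha_pos hc
    linarith
  have h3 : ‖u - w‖ = 0 := by
    have := sq_nonneg ‖u - w‖
    exact pow_eq_zero_iff (two_ne_zero) |>.1 (le_antisymm h2 this)
  exact sub_eq_zero.1 (norm_eq_zero.1 h3)

theorem IsFinslerEnergy.euler (hG : IsFinslerEnergy n G ℓ α) (q v : Evec n) :
    dvCLM G q v v = 2 * G q v := by
  have h1 : HasDerivAt (fun c : ℝ => G q (c • v)) (dvCLM G q v v) 1 := by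
    have h2 : HasDerivAt (fun c : ℝ => c • v) v 1 := by
      simpa using (hasDerivAt_id (1:ℝ)).smul_const v
    have h3 : HasFDerivAt (fun w => G q w) (dvCLM G q v) ((1:ℝ) • v) := by
      rw [one_smul]
      exact hG.hasFDerivAt_dv q v
    exact h3.comp_hasDerivAt 1 h2
  have h2 : HasDerivAt (fun c : ℝ => G q (c • v)) (2 * G q v) 1 := by
    have h3 : HasDerivAt (fun c : ℝ => c ^ 2 * G q v) (2 * G q v) 1 := by
      simpa using (hasDerivAt_pow 2 (1:ℝ)).mul_const (G q v)
    refine h3.congr_of_eventuallyEq ?_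
    filter_upwards [lt_mem_nhds (zero_lt_one' ℝ)] with c hc
    exact hG.homog q v c hc
  exact h1.unique h2

theorem IsFinslerEnergy.convex (hG : IsFinslerEnergy n G ℓ α) (q u v : Evec n) :
    dvCLM G q u v ≤ G q u + G q v := by
  set d := v - u with hd
  set g : ℝ → ℝ := fun t => G q (u + t • d) - t * dvCLM G q u d with hg
  have hgd : ∀ t : ℝ, HasDerivAt g (dvCLM G q (u + t • d) d - dvCLM G q u d) t := by
    intro t
    have h2 : HasDerivAt (fun t : ℝ => u + t • d) d t := by
      simpa using ((hasDerivAt_id t).smul_const d).const_add u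
    have h3 := (hG.hasFDerivAt_dv q (u + t • d)).comp_hasDerivAt t h2
    have := h3.fun_sub ((hasDerivAt_id' t).mul_const (dvCLM G q u d))
    rw [one_mul] at this
    exact this
  have hmono : MonotoneOn g (Icc 0 1) := by
    refine monotoneOn_of_deriv_nonneg (convex_Icc 0 1)
      (fun t _ => (hgd t).continuousAt.continuousWithinAt)
      (fun t _ => (hgd t).differentiableAt.differentiableWithinAt) ?_
    intro t ht
    rw [interior_Icc] at ht
    rw [(hgd t).deriv]
    have h1 := hG.dv_mono q (u + t • d) u
    have h2 : u + t • d - u = t • d := by abel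
    rw [h2, map_smul, smul_eq_mul, sub_apply] at h1
    have h3 : 0 ≤ α * ‖t • d‖ ^ 2 := by
      have := hG.alpha_pos
      positivity
    exact nonneg_of_mul_nonneg_right (h3.trans h1) ht.1
  have h01 := hmono (left_mem_Icc.2 zero_le_one) (right_mem_Icc.2 zero_le_one) zero_le_one
  have e1 : u + (1:ℝ) • d = v := by simp [d]
  simp only [hg, e1, zero_smul, add_zero, zero_mul, one_mul, sub_zero] at h01
  rw [hd, map_sub, hG.euler] at h01
  linarith

theorem IsFinslerEnergy.tendsto_inv (hG : IsFinslerEnergy n G ℓ α) {ι : Type*} {F : Filter ι}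
    [F.NeBot] {q v : ι → Evec n} {q0 : Evec n} {a0 : Evec n →L[ℝ] ℝ} (hq : Tendsto q F (𝓝 q0))
    (ha : Tendsto (fun i => dvCLM G (q i) (v i)) F (𝓝 a0)) :
    ∃ v0, Tendsto v F (𝓝 v0) ∧ dvCLM G q0 v0 = a0 := by
  have hbd : ∀ᶠ i in F, v i ∈ Metric.closedBall (0 : Evec n) ((‖a0‖ + 1) / α) := by
    filter_upwards [ha.norm.eventually (gt_mem_nhds (lt_add_one ‖a0‖))] with i hi
    rw [mem_closedBall_zero_iff, le_div_iff₀ hG.alpha_pos]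
    have h1 := hG.dv_mono (q i) (v i) 0
    rw [hG.dv_zero, sub_zero, sub_zero] at h1
    have h2 := (le_abs_self _).trans ((dvCLM G (q i) (v i)).le_opNorm (v i))
    rcases eq_or_lt_of_le (norm_nonneg (v i)) with h0 | h0
    · rw [← h0]
      have := norm_nonneg a0
      linarith
    · have h3 : (α * ‖v i‖) * ‖v i‖ ≤ ‖dvCLM G (q i) (v i)‖ * ‖v i‖ := by nlinarith
      have h4 := le_of_mul_le_mul_right h3 h0
      linarith
  have key : ∀ U : Ultrafilter ι, (U : Filter ι) ≤ F →
      ∃ u, Tendsto v U (𝓝 u) ∧ dvCLM G q0 u = a0 := by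
    intro U hU
    obtain ⟨u, -, hu⟩ := (isCompact_closedBall (0 : Evec n) ((‖a0‖ + 1) / α)).ultrafilter_le_nhds
      (U.map v) (by
        rw [le_principal_iff]
        exact hU hbd)
    have hu' : Tendsto v U (𝓝 u) := hu
    refine ⟨u, hu', ?_⟩
    have h1 : Tendsto (fun i => dvCLM G (q i) (v i)) U (𝓝 (dvCLM G q0 u)) :=
      (hG.continuous_dv.tendsto (q0, u)).comp ((hq.mono_left hU).prodMk_nhds hu')
    exact tendsto_nhds_unique h1 (ha.mono_left hU)
  obtain ⟨v0, hv0, h0⟩ := key (Ultrafilter.of F) (Ultrafilter.of_le F)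
  refine ⟨v0, ?_, h0⟩
  rw [tendsto_iff_ultrafilter]
  intro U hU
  obtain ⟨u, hu, h⟩ := key U hU
  rwa [hG.dv_inj (h0.trans h.symm)]

end FinslerFacts


open Topology

section Generic

/-- The ramp function rising linearly from `0` to `1` on `[s, s+h]`. -/
def ramp (s h r : ℝ) : ℝ := max 0 (min 1 ((r - s) / h))

theorem ramp_nonneg (s h r : ℝ) : 0 ≤ ramp s h r := le_max_left _ _

theorem ramp_le_one (s h r : ℝ) : ramp s h r ≤ 1 := max_le zero_le_one (min_le_left _ _)

theorem ramp_of_le {s h r : ℝ} (hh : 0 < h) (hr : r ≤ s) : ramp s h r = 0 := by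
  have : (r - s) / h ≤ 0 := div_nonpos_of_nonpos_of_nonneg (by linarith) hh.le
  exact max_eq_left ((min_le_right _ _).trans this)

theorem ramp_of_ge {s h r : ℝ} (hh : 0 < h) (hr : s + h ≤ r) : ramp s h r = 1 := by
  have : 1 ≤ (r - s) / h := by rw [le_div_iff₀ hh]; linarith
  unfold ramp
  rw [min_eq_left this, max_eq_right zero_le_one]

theorem ramp_of_mem {s h r : ℝ} (hh : 0 < h) (h1 : s ≤ r) (h2 : r ≤ s + h) :
    ramp s h r = (r - s) / h := by
  unfold ramp
  have : (r - s) / h ≤ 1 := by rw [div_le_iff₀ hh]; linarith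
  rw [min_eq_right this, max_eq_right (div_nonneg (by linarith) hh.le)]

theorem ramp_anti {s s' h : ℝ} (hh : 0 < h) (hs : s ≤ s') (r : ℝ) : ramp s' h r ≤ ramp s h r := by
  unfold ramp
  gcongr

theorem ramp_continuous (s h : ℝ) : Continuous (ramp s h) := by
  unfold ramp
  fun_prop

/-- The derivative of the ramp. -/
def rampD (s h : ℝ) : ℝ → ℝ := (Ioo s (s + h)).indicator (fun _ => h⁻¹)

theorem rampD_measurable (s h : ℝ) : Measurable (rampD s h) :=
  measurable_const.indicator measurableSet_Ioo

theorem rampD_abs_le {s h : ℝ} (hh : 0 < h) (r : ℝ) : |rampD s h r| ≤ h⁻¹ := by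
  unfold rampD
  by_cases hr : r ∈ Ioo s (s + h)
  · rw [indicator_of_mem hr, abs_of_pos (inv_pos.2 hh)]
  · rw [indicator_of_notMem hr, abs_zero]
    exact (inv_pos.2 hh).le

theorem ramp_hasDerivAt {s h r : ℝ} (hh : 0 < h) (hr : r ∉ ({s, s + h} : Set ℝ)) :
    HasDerivAt (ramp s h) (rampD s h r) r := by
  simp only [mem_insert_iff, mem_singleton_iff, not_or] at hr
  obtain ⟨h1, h2⟩ := hr
  rcases lt_or_gt_of_ne h1 with h1 | h1
  · have e : rampD s h r = 0 := indicator_of_notMem (fun h' => by linarith [h'.1]) _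
    rw [e]
    refine (hasDerivAt_const r (0:ℝ)).congr_of_eventuallyEq ?_
    filter_upwards [gt_mem_nhds h1] with u hu
    exact ramp_of_le hh hu.le
  rcases lt_or_gt_of_ne h2 with h2 | h2
  · have e : rampD s h r = h⁻¹ := indicator_of_mem (show r ∈ Ioo s (s + h) from ⟨h1, h2⟩) _
    rw [e]
    have : HasDerivAt (fun u : ℝ => (u - s) / h) (1 / h) r :=
      ((hasDerivAt_id' r).sub_const s).div_const h
    rw [one_div] at this
    refine this.congr_of_eventuallyEq ?_
    filter_upwards [lt_mem_nhds h1, gt_mem_nhds h2] with u hu hu'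
    exact ramp_of_mem hh hu.le hu'.le
  · have e : rampD s h r = 0 := indicator_of_notMem (fun h' => by linarith [h'.2]) _
    rw [e]
    refine (hasDerivAt_const r (1:ℝ)).congr_of_eventuallyEq ?_
    filter_upwards [lt_mem_nhds h2] with u hu
    exact ramp_of_ge hh hu.le

/-- Build an `H¹` curve from a continuous function with bounded derivative off a countable set. -/
def mkH1 {n : ℕ} (f f' : ℝ → Evec n) (hc : Continuous f) (C : Set ℝ) (hC : C.Countable)
    (hd : ∀ t ∉ C, HasDerivAt f (f' t) t) (hm : Measurable f')
    (K : ℝ) (hb : ∀ t ∈ Icc (0:ℝ) 1, ‖f' t‖ ≤ K) : H1Curve n 0 1 where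
  toFun := f
  deriv := f'
  deriv_integrable := by
    refine Measure.integrableOn_of_bounded (M := K) (by simp) hm.aestronglyMeasurable ?_
    exact (ae_restrict_iff' measurableSet_Icc).2 (Eventually.of_forall hb)
  deriv_sq_integrable := by
    refine Measure.integrableOn_of_bounded (M := K ^ 2) (by simp)
      (hm.norm.pow_const 2).aestronglyMeasurable ?_
    refine (ae_restrict_iff' measurableSet_Icc).2 (Eventually.of_forall fun t ht => ?_)
    rw [norm_pow, norm_norm]
    exact pow_le_pow_left₀ (norm_nonneg _) (hb t ht) 2
  eq_add_integral := by
    intro t ht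
    have hi : IntegrableOn f' (Icc 0 1) := by
      refine Measure.integrableOn_of_bounded (M := K) (by simp) hm.aestronglyMeasurable ?_
      exact (ae_restrict_iff' measurableSet_Icc).2 (Eventually.of_forall hb)
    have : ∫ s in (0:ℝ)..t, f' s = f t - f 0 := by
      refine integral_eq_of_hasDerivAt_off_countable f f' hC hc.continuousOn
        (fun s hs => hd s hs.2) ?_
      refine (intervalIntegrable_iff_integrableOn_Icc_of_le ht.1).2 (hi.mono_set ?_)
      exact Icc_subset_Icc_right ht.2
    rw [this]
    abel

theorem integral_indicator_const_mul {p q c : ℝ} (hp : 0 ≤ p) (hpq : p ≤ q) (hq : q ≤ 1)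
    (f : ℝ → ℝ) :
    ∫ r in (0:ℝ)..1, (Ioo p q).indicator (fun _ => c) r * f r = c * ∫ r in p..q, f r := by
  rw [intervalIntegral.integral_of_le zero_le_one, intervalIntegral.integral_of_le hpq,
    ← integral_const_mul]
  have e : (fun r => (Ioo p q).indicator (fun _ => c) r * f r) =
      (Ioo p q).indicator (fun r => c * f r) := by
    ext r
    by_cases hr : r ∈ Ioo p q <;> simp [hr]
  rw [e, setIntegral_indicator measurableSet_Ioo]
  have e2 : Ioc (0:ℝ) 1 ∩ Ioo p q = Ioo p q := by
    rw [inter_eq_right]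
    intro r hr
    exact ⟨lt_of_le_of_lt hp hr.1, hr.2.le.trans hq⟩
  rw [e2, integral_Ioc_eq_integral_Ioo]

/-- One-sided limit of a bounded antitone function, from the right. -/
theorem exists_tendsto_right {T : Set ℝ} {s0 C : ℝ} {f : ℝ → ℝ} (hT : T ⊆ Ioi s0)
    (hanti : AntitoneOn f T) (hC : ∀ s ∈ T, f s ≤ C) : ∃ c, Tendsto f (𝓝[T] s0) (𝓝 c) := by
  by_cases hne : T.Nonempty
  · have hbdd : BddAbove (f '' T) := ⟨C, by rintro _ ⟨s, hs, rfl⟩; exact hC s hs⟩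
    refine ⟨sSup (f '' T), ?_⟩
    rw [tendsto_order]
    constructor
    · intro c hc
      obtain ⟨_, ⟨t, ht, rfl⟩, hct⟩ := exists_lt_of_lt_csSup (hne.image f) hc
      filter_upwards [self_mem_nhdsWithin, mem_nhdsWithin_of_mem_nhds (gt_mem_nhds (hT ht))]
        with s hs hst
      exact hct.trans_le (hanti hs ht hst.le)
    · intro c hc
      filter_upwards [self_mem_nhdsWithin] with s hs
      exact (le_csSup hbdd (mem_image_of_mem f hs)).trans_lt hc
  · rw [not_nonempty_iff_eq_empty] at hne
    subst hne
    exact ⟨0, by simp⟩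

/-- One-sided limit of a bounded antitone function, from the left. -/
theorem exists_tendsto_left {T : Set ℝ} {s0 C : ℝ} {f : ℝ → ℝ} (hT : T ⊆ Iio s0)
    (hanti : AntitoneOn f T) (hC : ∀ s ∈ T, C ≤ f s) : ∃ c, Tendsto f (𝓝[T] s0) (𝓝 c) := by
  by_cases hne : T.Nonempty
  · have hbdd : BddBelow (f '' T) := ⟨C, by rintro _ ⟨s, hs, rfl⟩; exact hC s hs⟩
    refine ⟨sInf (f '' T), ?_⟩
    rw [tendsto_order]
    constructor
    · intro c hc
      filter_upwards [self_mem_nhdsWithin] with s hs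
      exact hc.trans_le (csInf_le hbdd (mem_image_of_mem f hs))
    · intro c hc
      obtain ⟨_, ⟨t, ht, rfl⟩, hct⟩ := exists_lt_of_csInf_lt (hne.image f) hc
      filter_upwards [self_mem_nhdsWithin, mem_nhdsWithin_of_mem_nhds (lt_mem_nhds (hT ht))]
        with s hs hst
      exact (hanti ht hs hst.le).trans_lt hct
  · rw [not_nonempty_iff_eq_empty] at hne
    subst hne
    exact ⟨0, by simp⟩

theorem clm_eq_sum {n : ℕ} (L : Evec n →L[ℝ] ℝ) :
    L = ∑ i : Fin n, L (EuclideanSpace.single i 1) • (EuclideanSpace.proj i : Evec n →L[ℝ] ℝ) := by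
  ext w
  have hw : w = ∑ i : Fin n, w i • EuclideanSpace.single i (1:ℝ) := by
    have := (EuclideanSpace.basisFun (Fin n) ℝ).sum_repr w
    simpa using this.symm
  conv_lhs => rw [hw]
  rw [map_sum]
  simp [mul_comm]

theorem exists_tendsto_clm {n : ℕ} {ι : Type*} {F : Filter ι} {y : ι → (Evec n →L[ℝ] ℝ)}
    (h : ∀ w, ∃ c, Tendsto (fun i => y i w) F (𝓝 c)) : ∃ L, Tendsto y F (𝓝 L) := by
  choose c hc using h
  refine ⟨∑ i : Fin n, c (EuclideanSpace.single i 1) •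
    (EuclideanSpace.proj i : Evec n →L[ℝ] ℝ), ?_⟩
  have e : y = fun j => ∑ i : Fin n, (y j) (EuclideanSpace.single i 1) •
      (EuclideanSpace.proj i : Evec n →L[ℝ] ℝ) := by
    ext1 j
    exact clm_eq_sum (y j)
  rw [e]
  exact tendsto_finsetSum _ fun i _ => (hc _).smul_const _

/-- A continuous function with nonnegative lower right Dini derivative is nondecreasing. -/
theorem le_of_dini {f : ℝ → ℝ} {p q : ℝ} (hpq : p ≤ q) (hf : ContinuousOn f (Icc p q))
    (h : ∀ s ∈ Ico p q, ∀ ε > 0, ∀ᶠ t in 𝓝[>] s, -(ε * (t - s)) ≤ f t - f s) : f p ≤ f q := by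
  have key := image_le_of_liminf_slope_right_le_deriv_boundary (f := fun t => - f t)
    (B := fun _ => - f p) (B' := fun _ => 0) hf.neg le_rfl continuousOn_const
    (fun t _ => hasDerivWithinAt_const _ _ _) (by
      intro s hs r hr
      apply Eventually.frequently
      filter_upwards [h s hs (r / 2) (half_pos hr), self_mem_nhdsWithin] with t ht hst
      have hst' : 0 < t - s := sub_pos.2 hst
      rw [slope_def_field, div_lt_iff₀ hst']
      nlinarith)
  have := key (right_mem_Icc.2 hpq)
  simpa using this

theorem eq_of_dini {f : ℝ → ℝ} {p q : ℝ} (hpq : p ≤ q) (hf : ContinuousOn f (Icc p q))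
    (h : ∀ s ∈ Icc p q, ∀ ε > 0, ∀ᶠ t in 𝓝 s, -(ε * |t - s|) ≤ f t - f s) : f p = f q := by
  apply le_antisymm
  · refine le_of_dini hpq hf fun s hs ε hε => ?_
    filter_upwards [mem_nhdsWithin_of_mem_nhds (h s (Ico_subset_Icc_self hs) ε hε),
      self_mem_nhdsWithin] with t ht hst
    rwa [abs_of_pos (sub_pos.2 hst)] at ht
  · have key := le_of_dini (f := fun t => f (p + q - t)) hpq ?_ ?_
    · simpa using key
    · refine hf.comp (by fun_prop) ?_
      intro t ht
      exact ⟨by linarith [ht.2], by linarith [ht.1]⟩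
    · intro s hs ε hε
      have h1 := h (p + q - s) ⟨by linarith [hs.2], by linarith [hs.1]⟩ ε hε
      have h2 : Tendsto (fun t : ℝ => p + q - t) (𝓝 s) (𝓝 (p + q - s)) :=
        (continuous_const.sub continuous_id).tendsto s
      filter_upwards [mem_nhdsWithin_of_mem_nhds (h2.eventually h1), self_mem_nhdsWithin]
        with t ht hst
      have e : p + q - t - (p + q - s) = -(t - s) := by ring
      rw [e, abs_neg, abs_of_pos (sub_pos.2 hst)] at ht
      exact ht

end Generic


open Topology

section Curve

variable {n : ℕ} {G : Evec n → Evec n → ℝ} {ℓ α : ℝ} {Φ : Evec n → ℝ} {δ₀ : ℝ}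

/-- The momentum along the curve. -/
def aF (G : Evec n → Evec n → ℝ) (x : H1Curve n 0 1) (s : ℝ) : Evec n →L[ℝ] ℝ :=
  dvCLM G (x.toFun s) (x.deriv s)

/-- The force along the curve. -/
def bF (G : Evec n → Evec n → ℝ) (x : H1Curve n 0 1) (s : ℝ) : Evec n →L[ℝ] ℝ :=
  dqCLM G (x.toFun s) (x.deriv s)

/-- The integrated force along the curve. -/
def BF (G : Evec n → Evec n → ℝ) (x : H1Curve n 0 1) (t : ℝ) : Evec n →L[ℝ] ℝ :=
  ∫ r in (0:ℝ)..t, bF G x r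

/-- The set of Lebesgue points of the momentum. -/
def goodS (G : Evec n → Evec n → ℝ) (x : H1Curve n 0 1) : Set ℝ :=
  {s | s ∈ Ioo (0:ℝ) 1 ∧ HasDerivAt (fun t => ∫ r in (0:ℝ)..t, aF G x r) (aF G x s) s}

/-- Admissible constant directions on `[c,d]`. -/
def Adm (Φ : Evec n → ℝ) (x : H1Curve n 0 1) (c d : ℝ) (w : Evec n) : Prop :=
  ∀ r ∈ Icc c d, Φ (x.toFun r) = 0 → fderiv ℝ Φ (x.toFun r) w ≤ 0

theorem H1Curve.intervalIntegrable (x : H1Curve n 0 1) : IntervalIntegrable x.deriv volume 0 1 :=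
  (intervalIntegrable_iff_integrableOn_Icc_of_le zero_le_one).2 x.deriv_integrable

theorem H1Curve.intervalIntegrable' (x : H1Curve n 0 1) {p q : ℝ} (hp : p ∈ Icc (0:ℝ) 1)
    (hq : q ∈ Icc (0:ℝ) 1) : IntervalIntegrable x.deriv volume p q := by
  refine x.intervalIntegrable.mono_set ?_
  rw [uIcc_of_le zero_le_one]
  exact uIcc_subset_Icc hp hq

theorem H1Curve.continuousOn (x : H1Curve n 0 1) : ContinuousOn x.toFun (Icc 0 1) := by
  have h1 : ContinuousOn (fun t => x.toFun 0 + ∫ s in (0:ℝ)..t, x.deriv s) (Icc 0 1) := by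
    refine continuousOn_const.add ?_
    exact intervalIntegral.continuousOn_primitive_interval' (by
      simpa [uIcc_of_le] using x.intervalIntegrable) (by simp) |>.mono (by simp [uIcc_of_le])
  exact h1.congr x.eq_add_integral

theorem H1Curve.aesm (x : H1Curve n 0 1) :
    AEStronglyMeasurable (fun s => (x.toFun s, x.deriv s)) (volume.restrict (Icc 0 1)) :=
  (x.continuousOn.aestronglyMeasurable measurableSet_Icc).prodMk x.deriv_integrable.1

theorem aF_integrableOn (hG : IsFinslerEnergy n G ℓ α) (x : H1Curve n 0 1) :
    IntegrableOn (aF G x) (Icc 0 1) := by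
  refine Integrable.mono' (x.deriv_integrable.norm.const_mul ℓ)
    (hG.continuous_dv.comp_aestronglyMeasurable x.aesm) ?_
  exact Eventually.of_forall fun s => hG.dv_le _ _

theorem bF_integrableOn (hG : IsFinslerEnergy n G ℓ α) (x : H1Curve n 0 1) :
    IntegrableOn (bF G x) (Icc 0 1) := by
  refine Integrable.mono' (x.deriv_sq_integrable.const_mul ℓ)
    (hG.continuous_dq.comp_aestronglyMeasurable x.aesm) ?_
  exact Eventually.of_forall fun s => hG.dq_le _ _

theorem aF_ii (hG : IsFinslerEnergy n G ℓ α) (x : H1Curve n 0 1) {p q : ℝ}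
    (hp : p ∈ Icc (0:ℝ) 1) (hq : q ∈ Icc (0:ℝ) 1) : IntervalIntegrable (aF G x) volume p q := by
  have h : IntervalIntegrable (aF G x) volume 0 1 :=
    (intervalIntegrable_iff_integrableOn_Icc_of_le zero_le_one).2 (aF_integrableOn hG x)
  refine h.mono_set ?_
  rw [uIcc_of_le zero_le_one]
  exact uIcc_subset_Icc hp hq

theorem bF_ii (hG : IsFinslerEnergy n G ℓ α) (x : H1Curve n 0 1) {p q : ℝ}
    (hp : p ∈ Icc (0:ℝ) 1) (hq : q ∈ Icc (0:ℝ) 1) : IntervalIntegrable (bF G x) volume p q := by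
  have h : IntervalIntegrable (bF G x) volume 0 1 :=
    (intervalIntegrable_iff_integrableOn_Icc_of_le zero_le_one).2 (bF_integrableOn hG x)
  refine h.mono_set ?_
  rw [uIcc_of_le zero_le_one]
  exact uIcc_subset_Icc hp hq

theorem BF_continuousOn (hG : IsFinslerEnergy n G ℓ α) (x : H1Curve n 0 1) :
    ContinuousOn (BF G x) (Icc 0 1) := by
  have := intervalIntegral.continuousOn_primitive_interval'
    (bF_ii hG x (left_mem_Icc.2 zero_le_one) (right_mem_Icc.2 zero_le_one))
    (left_mem_uIcc)
  rwa [uIcc_of_le zero_le_one] at this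

theorem BF_sub (hG : IsFinslerEnergy n G ℓ α) (x : H1Curve n 0 1) {p q : ℝ}
    (hp : p ∈ Icc (0:ℝ) 1) (hq : q ∈ Icc (0:ℝ) 1) : BF G x q - BF G x p = ∫ r in p..q, bF G x r :=
  intervalIntegral.integral_interval_sub_left (bF_ii hG x (left_mem_Icc.2 zero_le_one) hq)
    (bF_ii hG x (left_mem_Icc.2 zero_le_one) hp)

theorem goodS_sub (x : H1Curve n 0 1) : goodS G x ⊆ Ioo 0 1 := fun _ h => h.1

theorem goodS_ae (hG : IsFinslerEnergy n G ℓ α) (x : H1Curve n 0 1) :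
    ∀ᵐ s : ℝ, s ∈ Ioo (0:ℝ) 1 → s ∈ goodS G x := by
  have := (aF_ii hG x (left_mem_Icc.2 zero_le_one)
    (right_mem_Icc.2 zero_le_one)).ae_hasDerivAt_integral
  filter_upwards [this] with s hs hs'
  refine ⟨hs', hs ?_ 0 (by simp)⟩
  rw [uIcc_of_le zero_le_one]
  exact Ioo_subset_Icc_self hs'

theorem goodS_exists (hG : IsFinslerEnergy n G ℓ α) (x : H1Curve n 0 1) {p q : ℝ} (hp : 0 ≤ p)
    (hpq : p < q) (hq : q ≤ 1) : ∃ s ∈ goodS G x, s ∈ Ioo p q := by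
  by_contra hcon
  push Not at hcon
  have h1 : ∀ᵐ s : ℝ, s ∉ Ioo p q := by
    filter_upwards [goodS_ae hG x] with s hs hs'
    exact hcon s (hs ⟨lt_of_le_of_lt hp hs'.1, lt_of_lt_of_le hs'.2 hq⟩) hs'
  have h2 : volume (Ioo p q) = 0 := by
    rw [ae_iff] at h1
    refine measure_mono_null (fun s hs => ?_) h1
    exact not_not.2 hs
  rw [Real.volume_Ioo, ENNReal.ofReal_eq_zero] at h2
  linarith

theorem mono_goodS (hG : IsFinslerEnergy n G ℓ α) {x : H1Curve n 0 1} (hx : IsVCritical G Φ x)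
    {s t : ℝ} (hs : s ∈ goodS G x) (ht : t ∈ goodS G x) (hst : s < t) {w : Evec n}
    (hw : Adm Φ x s t w) : (aF G x t - BF G x t) w ≤ (aF G x s - BF G x s) w := by
  have hs0 := hs.1.1
  have ht1 := ht.1.2
  have I0 : (0:ℝ) ∈ Icc (0:ℝ) 1 := left_mem_Icc.2 zero_le_one
  have I1 : (1:ℝ) ∈ Icc (0:ℝ) 1 := right_mem_Icc.2 zero_le_one
  have Is : s ∈ Icc (0:ℝ) 1 := Ioo_subset_Icc_self hs.1
  have It : t ∈ Icc (0:ℝ) 1 := Ioo_subset_Icc_self ht.1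
  set φ : ℝ → ℝ → ℝ := fun h r => ramp s h r - ramp (t - h) h r with hφ
  set A : ℝ → (Evec n →L[ℝ] ℝ) := fun t => ∫ r in (0:ℝ)..t, aF G x r with hA
  have hbw : ∀ {p q : ℝ}, p ∈ Icc (0:ℝ) 1 → q ∈ Icc (0:ℝ) 1 →
      IntervalIntegrable (fun r => bF G x r w) volume p q := fun hp hq =>
    ⟨(ContinuousLinearMap.apply ℝ ℝ w).integrable_comp (bF_ii hG x hp hq).1,
      (ContinuousLinearMap.apply ℝ ℝ w).integrable_comp (bF_ii hG x hp hq).2⟩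
  have haw : ∀ {p q : ℝ}, p ∈ Icc (0:ℝ) 1 → q ∈ Icc (0:ℝ) 1 →
      IntervalIntegrable (fun r => aF G x r w) volume p q := fun hp hq =>
    ⟨(ContinuousLinearMap.apply ℝ ℝ w).integrable_comp (aF_ii hG x hp hq).1,
      (ContinuousLinearMap.apply ℝ ℝ w).integrable_comp (aF_ii hG x hp hq).2⟩
  have haint : ∀ {p q : ℝ}, p ∈ Icc (0:ℝ) 1 → q ∈ Icc (0:ℝ) 1 →
      ∫ r in p..q, aF G x r w = (A q - A p) w := by
    intro p q hp hq
    rw [hA, intervalIntegral.integral_interval_sub_left (aF_ii hG x I0 hq) (aF_ii hG x I0 hp)]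
    exact (ContinuousLinearMap.apply ℝ ℝ w).intervalIntegral_comp_comm (aF_ii hG x hp hq)
  have hbint : ∀ {p q : ℝ}, p ∈ Icc (0:ℝ) 1 → q ∈ Icc (0:ℝ) 1 →
      ∫ r in p..q, bF G x r w = (BF G x q - BF G x p) w := by
    intro p q hp hq
    rw [BF_sub hG x hp hq]
    exact (ContinuousLinearMap.apply ℝ ℝ w).intervalIntegral_comp_comm (bF_ii hG x hp hq)
  have key : ∀ h ∈ Ioo 0 (t - s), 0 ≤ (∫ r in (0:ℝ)..1, φ h r * bF G x r w) +
      ((h⁻¹ • (A (s + h) - A s)) w - (h⁻¹ • (A t - A (t - h))) w) := by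
    intro h hh
    have hh0 := hh.1
    have hh1 := hh.2
    have hm : Measurable fun r => (rampD s h r - rampD (t - h) h r) • w :=
      ((rampD_measurable s h).sub (rampD_measurable (t - h) h)).smul_const w
    set ξ : H1Curve n 0 1 := mkH1 (fun r => φ h r • w)
      (fun r => (rampD s h r - rampD (t - h) h r) • w)
      (((ramp_continuous s h).sub (ramp_continuous (t - h) h)).smul continuous_const)
      ({s, s + h} ∪ {t - h, t - h + h}) ((toFinite _).countable.union (toFinite _).countable)
      (fun r hr => by
        rw [mem_union, not_or] at hr
        exact ((ramp_hasDerivAt hh0 hr.1).fun_sub (ramp_hasDerivAt hh0 hr.2)).smul_const w)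
      hm ((h⁻¹ + h⁻¹) * ‖w‖) (fun r _ => by
        rw [norm_smul, Real.norm_eq_abs]
        gcongr
        exact (abs_sub _ _).trans (add_le_add (rampD_abs_le hh0 r) (rampD_abs_le hh0 r)))
      with hξ
    have hmem : MemVminus Φ x ξ := by
      refine ⟨?_, ?_, ?_⟩
      · have : ξ.toFun 0 = 0 := by
          change φ h 0 • w = 0
          simp only [hφ]
          rw [ramp_of_le hh0 hs0.le, ramp_of_le hh0 (by linarith)]
          simp
        rw [this, inner_zero_right]
      · have : ξ.toFun 1 = 0 := by
          change φ h 1 • w = 0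
          simp only [hφ]
          rw [ramp_of_ge hh0 (by linarith), ramp_of_ge hh0 (by linarith)]
          simp
        rw [this, inner_zero_right]
      · intro r hr hr0
        change ⟪gradient Φ (x.toFun r), φ h r • w⟫ ≤ 0
        rw [inner_smul_right, inner_gradient_left]
        by_cases hrst : r ∈ Icc s t
        · have h1 := hw r hrst hr0
          have h2 : 0 ≤ φ h r := sub_nonneg.2 (ramp_anti hh0 (by linarith) r)
          exact mul_nonpos_of_nonneg_of_nonpos h2 h1
        · have : φ h r = 0 := by
            simp only [hφ]
            rcases lt_or_ge r s with h1 | h1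
            · rw [ramp_of_le hh0 h1.le, ramp_of_le hh0 (by linarith)]
              simp
            · have h2 : t < r := by
                by_contra hc
                exact hrst ⟨h1, not_lt.1 hc⟩
              rw [ramp_of_ge hh0 (by linarith), ramp_of_ge hh0 (by linarith)]
              simp
          rw [this, zero_mul]
    have h0 := hx.2 ξ hmem
    have e : dJ G x ξ = (1/2) * ∫ r in (0:ℝ)..1, (φ h r * bF G x r w +
        (rampD s h r * aF G x r w - rampD (t - h) h r * aF G x r w)) := by
      unfold dJ
      congr 1
      apply intervalIntegral.integral_congr
      intro r _
      change dqCLM G (x.toFun r) (x.deriv r) (φ h r • w) + dvCLM G (x.toFun r) (x.deriv r)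
        ((rampD s h r - rampD (t - h) h r) • w) = _
      rw [map_smul, map_smul, smul_eq_mul, smul_eq_mul]
      change _ = φ h r * dqCLM G (x.toFun r) (x.deriv r) w +
        (rampD s h r * dvCLM G (x.toFun r) (x.deriv r) w -
          rampD (t - h) h r * dvCLM G (x.toFun r) (x.deriv r) w)
      ring
    rw [e] at h0
    have i1 : IntervalIntegrable (fun r => φ h r * bF G x r w) volume 0 1 :=
      (hbw I0 I1).continuousOn_mul
        ((ramp_continuous s h).sub (ramp_continuous (t - h) h)).continuousOn
    have i2 : ∀ p, IntervalIntegrable (fun r => rampD p h r * aF G x r w) volume 0 1 := by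
      intro p
      have h1 := (haw I0 I1).1
      rw [intervalIntegrable_iff_integrableOn_Ioc_of_le zero_le_one]
      refine Integrable.bdd_mul (c := h⁻¹) h1 (rampD_measurable p h).aestronglyMeasurable ?_
      exact Eventually.of_forall fun r => rampD_abs_le hh0 r
    rw [intervalIntegral.integral_add i1 ((i2 s).sub (i2 (t - h))),
      intervalIntegral.integral_sub (i2 s) (i2 (t - h))] at h0
    have e1 : ∫ r in (0:ℝ)..1, rampD s h r * aF G x r w = h⁻¹ * ∫ r in s..(s+h), aF G x r w :=
      integral_indicator_const_mul hs0.le (by linarith) (by linarith) _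
    have e2 : ∫ r in (0:ℝ)..1, rampD (t - h) h r * aF G x r w =
        h⁻¹ * ∫ r in (t - h)..(t - h + h), aF G x r w :=
      integral_indicator_const_mul (by linarith) (by linarith) (by linarith) _
    rw [e1, e2, haint Is ⟨by linarith, by linarith⟩, sub_add_cancel,
      haint ⟨by linarith, by linarith⟩ It] at h0
    simp only [smul_apply, smul_eq_mul]
    linarith
  -- limits
  have l1 : Tendsto (fun h => ∫ r in (0:ℝ)..1, φ h r * bF G x r w) (𝓝[>] 0)
      (𝓝 (∫ r in (0:ℝ)..1, (Ioo s t).indicator (fun _ => (1:ℝ)) r * bF G x r w)) := by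
    refine intervalIntegral.tendsto_integral_filter_of_dominated_convergence
      (fun r => ‖bF G x r w‖) ?_ ?_ (hbw I0 I1).norm ?_
    · refine Eventually.of_forall fun h => ?_
      refine (((ramp_continuous s h).sub
        (ramp_continuous (t - h) h)).aestronglyMeasurable).mul ?_
      have := (hbw I0 I1).aestronglyMeasurable
      rwa [uIoc_of_le zero_le_one]
    · refine Eventually.of_forall fun h => Eventually.of_forall fun r _ => ?_
      rw [norm_mul]
      refine mul_le_of_le_one_left (norm_nonneg _) ?_
      rw [Real.norm_eq_abs, abs_le]
      have h1 := ramp_nonneg s h r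
      have h2 := ramp_nonneg (t - h) h r
      have h3 := ramp_le_one s h r
      have h4 := ramp_le_one (t - h) h r
      constructor <;> simp only [hφ] <;> linarith
    · refine Eventually.of_forall fun r _ => ?_
      refine Tendsto.mul_const _ ?_
      refine tendsto_const_nhds.congr' ?_
      by_cases hr : r ∈ Ioo s t
      · have hpos : 0 < min (r - s) (t - r) := lt_min (by linarith [hr.1]) (by linarith [hr.2])
        filter_upwards [Ioo_mem_nhdsGT hpos] with h hh
        have h1 := hh.2.trans_le (min_le_left _ _)
        have h2 := hh.2.trans_le (min_le_right _ _)
        rw [indicator_of_mem hr]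
        simp only [hφ]
        rw [ramp_of_ge hh.1 (by linarith), ramp_of_le hh.1 (by linarith)]
        simp
      · rw [indicator_of_notMem hr]
        rcases le_or_gt r s with h1 | h1
        · filter_upwards [Ioo_mem_nhdsGT (sub_pos.2 hst)] with h hh
          simp only [hφ]
          rw [ramp_of_le hh.1 h1, ramp_of_le hh.1 (by linarith [hh.2])]
          simp
        · have h2 : t ≤ r := by
            by_contra hc
            exact hr ⟨h1, not_le.1 hc⟩
          filter_upwards [Ioo_mem_nhdsGT (sub_pos.2 hst)] with h hh
          simp only [hφ]
          rw [ramp_of_ge hh.1 (by linarith [hh.2]), ramp_of_ge hh.1 (by linarith [hh.2])]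
          simp
  rw [integral_indicator_const_mul hs0.le hst.le ht1.le, one_mul, hbint Is It] at l1
  have l2 : Tendsto (fun h : ℝ => (h⁻¹ • (A (s + h) - A s)) w) (𝓝[>] 0) (𝓝 (aF G x s w)) :=
    ((ContinuousLinearMap.apply ℝ ℝ w).continuous.tendsto _).comp hs.2.tendsto_slope_zero_right
  have l3 : Tendsto (fun h : ℝ => (h⁻¹ • (A t - A (t - h))) w) (𝓝[>] 0) (𝓝 (aF G x t w)) := by
    have h1 := ht.2.tendsto_slope_zero_left
    have h2 : Tendsto (fun h : ℝ => -h) (𝓝[>] 0) (𝓝[<] 0) := by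
      have := tendsto_neg_nhdsGT (a := (0:ℝ))
      rwa [neg_zero] at this
    have h3 := ((ContinuousLinearMap.apply ℝ ℝ w).continuous.tendsto _).comp (h1.comp h2)
    refine h3.congr fun h => ?_
    change ((-h)⁻¹ • (A (t + -h) - A t)) w = _
    rw [← sub_eq_add_neg, inv_neg]
    simp only [smul_apply, sub_apply, smul_eq_mul]
    ring
  have hlim := ge_of_tendsto (l1.add (l2.sub l3)) (by
    filter_upwards [Ioo_mem_nhdsGT (sub_pos.2 hst)] with h hh
    exact key h hh)
  simp only [sub_apply] at hlim ⊢
  linarith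

end Curve


open Topology

section Limits

variable {n : ℕ} {G : Evec n → Evec n → ℝ} {ℓ α : ℝ} {Φ : Evec n → ℝ} {δ₀ : ℝ}

/-- Directions admissible near `s0`. -/
def Good (Φ : Evec n → ℝ) (x : H1Curve n 0 1) (s0 : ℝ) (w : Evec n) : Prop :=
  ∃ δ > 0, ∀ r ∈ Icc (0:ℝ) 1, |r - s0| < δ → Φ (x.toFun r) = 0 → fderiv ℝ Φ (x.toFun r) w ≤ 0

/-- The reduced momentum. -/
def yF (G : Evec n → Evec n → ℝ) (x : H1Curve n 0 1) (s : ℝ) : Evec n →L[ℝ] ℝ :=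
  aF G x s - BF G x s

theorem IsRegularDomain.continuous_fderiv (hΦ : IsRegularDomain n Φ δ₀) :
    Continuous (fderiv ℝ Φ) := hΦ.smooth.continuous_fderiv (by norm_num)

theorem IsRegularDomain.differentiable (hΦ : IsRegularDomain n Φ δ₀) :
    Differentiable ℝ Φ := hΦ.smooth.differentiable (by norm_num)

theorem IsRegularDomain.continuous (hΦ : IsRegularDomain n Φ δ₀) :
    Continuous Φ := hΦ.smooth.continuous

theorem IsRegularDomain.grad_pos (hΦ : IsRegularDomain n Φ δ₀) {q : Evec n} (hq : Φ q = 0) :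
    0 < fderiv ℝ Φ q (gradient Φ q) := by
  rw [← inner_gradient_left, real_inner_self_eq_norm_sq]
  have : gradient Φ q ≠ 0 := hΦ.grad_ne_zero q (by rw [hq, abs_zero]; exact hΦ.delta0_pos.le)
  positivity

theorem good_neg (hΦ : IsRegularDomain n Φ δ₀) (x : H1Curve n 0 1) {s0 : ℝ}
    (hs0 : s0 ∈ Icc (0:ℝ) 1) {w : Evec n}
    (h : Φ (x.toFun s0) = 0 → fderiv ℝ Φ (x.toFun s0) w < 0) : Good Φ x s0 w := by
  have hx := x.continuousOn s0 hs0
  have ev : ∀ᶠ r in 𝓝[Icc 0 1] s0, Φ (x.toFun r) = 0 → fderiv ℝ Φ (x.toFun r) w ≤ 0 := by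
    by_cases h0 : Φ (x.toFun s0) = 0
    · have h1 : Tendsto (fun r => fderiv ℝ Φ (x.toFun r) w) (𝓝[Icc 0 1] s0)
          (𝓝 (fderiv ℝ Φ (x.toFun s0) w)) :=
        ((hΦ.continuous_fderiv.clm_apply continuous_const).tendsto _).comp hx
      filter_upwards [h1.eventually_lt_const (h h0)] with r hr _
      exact hr.le
    · have h1 : Tendsto (fun r => Φ (x.toFun r)) (𝓝[Icc 0 1] s0) (𝓝 (Φ (x.toFun s0))) :=
        (hΦ.continuous.tendsto _).comp hx
      filter_upwards [h1.eventually_ne h0] with r hr hr'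
      exact absurd hr' hr
  rw [Metric.nhdsWithin_basis_ball.eventually_iff] at ev
  obtain ⟨δ, hδ, h2⟩ := ev
  exact ⟨δ, hδ, fun r hr hrd => h2 ⟨by rwa [Metric.mem_ball, Real.dist_eq], hr⟩⟩

theorem good_split (hΦ : IsRegularDomain n Φ δ₀) (x : H1Curve n 0 1) {s0 : ℝ}
    (hs0 : s0 ∈ Icc (0:ℝ) 1) (w : Evec n) : ∃ u, Good Φ x s0 u ∧ Good Φ x s0 (w + u) := by
  set g := gradient Φ (x.toFun s0)
  set N := fderiv ℝ Φ (x.toFun s0)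
  refine ⟨-((|N w| + 1) / N g) • g, good_neg hΦ x hs0 fun h => ?_, good_neg hΦ x hs0 fun h => ?_⟩
  all_goals
    have hp : 0 < N g := hΦ.grad_pos h
    have e : N (-((|N w| + 1) / N g) • g) = -(|N w| + 1) := by
      rw [map_smul, smul_eq_mul, neg_mul, div_mul_cancel₀ _ hp.ne']
  · change N _ < 0
    rw [e]
    linarith [abs_nonneg (N w)]
  · change N _ < 0
    rw [map_add, e]
    linarith [le_abs_self (N w)]

theorem goodS_neBot_right (hG : IsFinslerEnergy n G ℓ α) (x : H1Curve n 0 1) {s0 : ℝ}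
    (hs0 : s0 ∈ Ico (0:ℝ) 1) : (𝓝[goodS G x ∩ Ioi s0] s0).NeBot := by
  rw [← mem_closure_iff_nhdsWithin_neBot, Metric.mem_closure_iff]
  intro ε hε
  obtain ⟨s, hs, hs'⟩ := goodS_exists hG x hs0.1 (q := min 1 (s0 + ε))
    (lt_min hs0.2 (by linarith)) (min_le_left _ _)
  refine ⟨s, ⟨hs, hs'.1⟩, ?_⟩
  rw [dist_comm, Real.dist_eq, abs_of_pos (by linarith [hs'.1])]
  linarith [hs'.2.trans_le (min_le_right _ _)]

theorem goodS_neBot_left (hG : IsFinslerEnergy n G ℓ α) (x : H1Curve n 0 1) {s0 : ℝ}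
    (hs0 : s0 ∈ Ioc (0:ℝ) 1) : (𝓝[goodS G x ∩ Iio s0] s0).NeBot := by
  rw [← mem_closure_iff_nhdsWithin_neBot, Metric.mem_closure_iff]
  intro ε hε
  obtain ⟨s, hs, hs'⟩ := goodS_exists hG x (le_max_left _ _) (p := max 0 (s0 - ε)) (q := s0)
    (max_lt hs0.1 (by linarith)) hs0.2
  refine ⟨s, ⟨hs, hs'.2⟩, ?_⟩
  rw [Real.dist_eq, abs_of_pos (by linarith [hs'.2])]
  linarith [(le_max_right _ _).trans_lt hs'.1]

theorem limit_right (hG : IsFinslerEnergy n G ℓ α) (hΦ : IsRegularDomain n Φ δ₀)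
    {x : H1Curve n 0 1} (hx : IsVCritical G Φ x) {s0 : ℝ} (hs0 : s0 ∈ Icc (0:ℝ) 1)
    (hb : ∀ w, Good Φ x s0 w → ∃ C, ∀ᶠ s in 𝓝[goodS G x ∩ Ioi s0] s0, yF G x s w ≤ C) :
    ∃ L, Tendsto (yF G x) (𝓝[goodS G x ∩ Ioi s0] s0) (𝓝 L) := by
  have key : ∀ w, Good Φ x s0 w →
      ∃ c, Tendsto (fun s => yF G x s w) (𝓝[goodS G x ∩ Ioi s0] s0) (𝓝 c) := by
    intro w hw
    obtain ⟨C, hC⟩ := hb w hw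
    obtain ⟨δ, hδ, hd⟩ := hw
    obtain ⟨c, hc⟩ := exists_tendsto_right (s0 := s0) (C := C) (f := fun s => yF G x s w)
      (T := {s | s ∈ goodS G x ∩ Ioi s0 ∧ s < s0 + δ ∧ yF G x s w ≤ C})
      (fun s hs => hs.1.2) (by
        intro s hs t ht hst
        rcases hst.eq_or_lt with rfl | hst
        · exact le_rfl
        · refine mono_goodS hG hx hs.1.1 ht.1.1 hst fun r hr => ?_
          have h1 : s0 < s := hs.1.2
          refine hd r ⟨hs.1.1.1.1.le.trans hr.1, hr.2.trans ht.1.1.1.2.le⟩ ?_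
          rw [abs_of_pos (by linarith [hr.1])]
          linarith [hr.2, ht.2.1]) (fun s hs => hs.2.2)
    refine ⟨c, hc.mono_left (nhdsWithin_le_iff.2 ?_)⟩
    filter_upwards [hC, self_mem_nhdsWithin,
      mem_nhdsWithin_of_mem_nhds (Iio_mem_nhds (by linarith : s0 < s0 + δ))] with s h1 h2 h3
    exact ⟨h2, h3, h1⟩
  refine exists_tendsto_clm fun w => ?_
  obtain ⟨u, h1, h2⟩ := good_split hΦ x hs0 w
  obtain ⟨c1, hc1⟩ := key _ h1
  obtain ⟨c2, hc2⟩ := key _ h2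
  refine ⟨c2 - c1, (hc2.sub hc1).congr fun s => ?_⟩
  rw [map_add, add_sub_cancel_right]

theorem limit_left (hG : IsFinslerEnergy n G ℓ α) (hΦ : IsRegularDomain n Φ δ₀)
    {x : H1Curve n 0 1} (hx : IsVCritical G Φ x) {s0 : ℝ} (hs0 : s0 ∈ Icc (0:ℝ) 1)
    (hb : ∀ w, Good Φ x s0 w → ∃ C, ∀ᶠ s in 𝓝[goodS G x ∩ Iio s0] s0, C ≤ yF G x s w) :
    ∃ L, Tendsto (yF G x) (𝓝[goodS G x ∩ Iio s0] s0) (𝓝 L) := by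
  have key : ∀ w, Good Φ x s0 w →
      ∃ c, Tendsto (fun s => yF G x s w) (𝓝[goodS G x ∩ Iio s0] s0) (𝓝 c) := by
    intro w hw
    obtain ⟨C, hC⟩ := hb w hw
    obtain ⟨δ, hδ, hd⟩ := hw
    obtain ⟨c, hc⟩ := exists_tendsto_left (s0 := s0) (C := C) (f := fun s => yF G x s w)
      (T := {s | s ∈ goodS G x ∩ Iio s0 ∧ s0 - δ < s ∧ C ≤ yF G x s w})
      (fun s hs => hs.1.2) (by
        intro s hs t ht hst
        rcases hst.eq_or_lt with rfl | hst
        · exact le_rfl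
        · refine mono_goodS hG hx hs.1.1 ht.1.1 hst fun r hr => ?_
          have h1 : t < s0 := ht.1.2
          refine hd r ⟨hs.1.1.1.1.le.trans hr.1, hr.2.trans ht.1.1.1.2.le⟩ ?_
          rw [abs_of_neg (by linarith [hr.2])]
          linarith [hr.1, hs.2.1]) (fun s hs => hs.2.2)
    refine ⟨c, hc.mono_left (nhdsWithin_le_iff.2 ?_)⟩
    filter_upwards [hC, self_mem_nhdsWithin,
      mem_nhdsWithin_of_mem_nhds (Ioi_mem_nhds (by linarith : s0 - δ < s0))] with s h1 h2 h3
    exact ⟨h2, h3, h1⟩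
  refine exists_tendsto_clm fun w => ?_
  obtain ⟨u, h1, h2⟩ := good_split hΦ x hs0 w
  obtain ⟨c1, hc1⟩ := key _ h1
  obtain ⟨c2, hc2⟩ := key _ h2
  refine ⟨c2 - c1, (hc2.sub hc1).congr fun s => ?_⟩
  rw [map_add, add_sub_cancel_right]

theorem deriv_limit (hG : IsFinslerEnergy n G ℓ α) (x : H1Curve n 0 1) {s0 : ℝ}
    (hs0 : s0 ∈ Icc (0:ℝ) 1) {T : Set ℝ} (hT : T ⊆ Icc 0 1) [(𝓝[T] s0).NeBot]
    {L : Evec n →L[ℝ] ℝ} (hL : Tendsto (yF G x) (𝓝[T] s0) (𝓝 L)) :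
    ∃ v, Tendsto x.deriv (𝓝[T] s0) (𝓝 v) ∧ dvCLM G (x.toFun s0) v = L + BF G x s0 := by
  have hle : 𝓝[T] s0 ≤ 𝓝[Icc 0 1] s0 := nhdsWithin_mono _ hT
  have h1 : Tendsto x.toFun (𝓝[T] s0) (𝓝 (x.toFun s0)) := (x.continuousOn s0 hs0).mono_left hle
  have h2 : Tendsto (BF G x) (𝓝[T] s0) (𝓝 (BF G x s0)) :=
    (BF_continuousOn hG x s0 hs0).mono_left hle
  refine hG.tendsto_inv h1 (a0 := L + BF G x s0) ((hL.add h2).congr fun s => ?_)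
  simp only [yF, sub_add_cancel, aF]

theorem ae_filter_right (hG : IsFinslerEnergy n G ℓ α) (x : H1Curve n 0 1) {s0 : ℝ}
    (hs0 : s0 ∈ Ico (0:ℝ) 1) : 𝓝[>] s0 ⊓ ae volume ≤ 𝓝[goodS G x ∩ Ioi s0] s0 := by
  refine le_inf (inf_le_left.trans inf_le_left) (le_principal_iff.2 ?_)
  have h1 : ∀ᶠ s in 𝓝[>] s0 ⊓ ae volume, s ∈ Ioo s0 1 :=
    (Ioo_mem_nhdsGT hs0.2 : Ioo s0 1 ∈ 𝓝[>] s0) |> fun h => mem_inf_of_left h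
  have h2 : ∀ᶠ s in 𝓝[>] s0 ⊓ ae volume, s ∈ Ioo (0:ℝ) 1 → s ∈ goodS G x :=
    mem_inf_of_right (goodS_ae hG x)
  filter_upwards [h1, h2] with s hs hs'
  exact ⟨hs' ⟨hs0.1.trans_lt hs.1, hs.2⟩, hs.1⟩

theorem ae_filter_left (hG : IsFinslerEnergy n G ℓ α) (x : H1Curve n 0 1) {s0 : ℝ}
    (hs0 : s0 ∈ Ioc (0:ℝ) 1) : 𝓝[≤] s0 ⊓ ae volume ≤ 𝓝[goodS G x ∩ Iio s0] s0 := by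
  refine le_inf (inf_le_left.trans inf_le_left) (le_principal_iff.2 ?_)
  have h1 : ∀ᶠ s in 𝓝[≤] s0 ⊓ ae volume, s ∈ Ioc 0 s0 :=
    (Ioc_mem_nhdsLE hs0.1 : Ioc 0 s0 ∈ 𝓝[≤] s0) |> fun h => mem_inf_of_left h
  have h2 : ∀ᶠ s in 𝓝[≤] s0 ⊓ ae volume, s ∈ Ioo (0:ℝ) 1 → s ∈ goodS G x :=
    mem_inf_of_right (goodS_ae hG x)
  have h3 : ∀ᶠ s in 𝓝[≤] s0 ⊓ ae volume, s ≠ s0 :=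
    mem_inf_of_right (by simp [mem_ae_iff])
  filter_upwards [h1, h2, h3] with s hs hs' h4
  have h5 := lt_of_le_of_ne hs.2 h4
  exact ⟨hs' ⟨hs.1, h5.trans_le hs0.2⟩, h5⟩

theorem xder_right (hG : IsFinslerEnergy n G ℓ α) (x : H1Curve n 0 1) {s0 : ℝ}
    (hs0 : s0 ∈ Ico (0:ℝ) 1) {v : Evec n}
    (hv : Tendsto x.deriv (𝓝[goodS G x ∩ Ioi s0] s0) (𝓝 v)) :
    HasDerivWithinAt x.toFun v (Ici s0) s0 := by
  have hs0' : s0 ∈ Icc (0:ℝ) 1 := Ico_subset_Icc_self hs0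
  have h := intervalIntegral.integral_hasDerivWithinAt_of_tendsto_ae_right (s := Ici s0)
    (t := Ioi s0) (x.intervalIntegrable' (left_mem_Icc.2 zero_le_one) hs0')
    (⟨Icc 0 1, mem_of_superset (Ioo_mem_nhdsGT hs0.2)
      (fun r hr => ⟨hs0.1.trans hr.1.le, hr.2.le⟩), x.deriv_integrable.1⟩)
    (hv.mono_left (ae_filter_right hG x hs0))
  refine ((h.const_add (x.toFun 0))).congr_of_eventuallyEq ?_ (x.eq_add_integral s0 hs0')
  filter_upwards [Ico_mem_nhdsGE hs0.2] with r hr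
  exact x.eq_add_integral r ⟨hs0.1.trans hr.1, hr.2.le⟩

theorem xder_left (hG : IsFinslerEnergy n G ℓ α) (x : H1Curve n 0 1) {s0 : ℝ}
    (hs0 : s0 ∈ Ioc (0:ℝ) 1) {v : Evec n}
    (hv : Tendsto x.deriv (𝓝[goodS G x ∩ Iio s0] s0) (𝓝 v)) :
    HasDerivWithinAt x.toFun v (Iic s0) s0 := by
  have hs0' : s0 ∈ Icc (0:ℝ) 1 := Ioc_subset_Icc_self hs0
  have h := intervalIntegral.integral_hasDerivWithinAt_of_tendsto_ae_right (s := Iic s0)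
    (t := Iic s0) (x.intervalIntegrable' (left_mem_Icc.2 zero_le_one) hs0')
    (⟨Icc 0 1, mem_of_superset (Ioc_mem_nhdsLE hs0.1)
      (fun r hr => ⟨hr.1.le, hr.2.trans hs0.2⟩), x.deriv_integrable.1⟩)
    (hv.mono_left (ae_filter_left hG x hs0))
  refine ((h.const_add (x.toFun 0))).congr_of_eventuallyEq ?_ (x.eq_add_integral s0 hs0')
  filter_upwards [Ioc_mem_nhdsLE hs0.1] with r hr
  exact x.eq_add_integral r ⟨hr.1.le, hr.2.trans hs0.2⟩

/-- At an interior point, the derivative has a limit along the Lebesgue points, and agrees with it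
if the point is a Lebesgue point. -/
theorem interior_limit (hG : IsFinslerEnergy n G ℓ α) (hΦ : IsRegularDomain n Φ δ₀)
    {x : H1Curve n 0 1} (hx : IsVCritical G Φ x) {s0 : ℝ} (hs0 : s0 ∈ Ioo (0:ℝ) 1) :
    ∃ v, Tendsto x.deriv (𝓝[goodS G x] s0) (𝓝 v) := by
  have hI : s0 ∈ Icc (0:ℝ) 1 := Ioo_subset_Icc_self hs0
  have nbR := goodS_neBot_right hG x (Ioo_subset_Ico_self hs0)
  have nbL := goodS_neBot_left hG x (Ioo_subset_Ioc_self hs0)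
  have hSI : goodS G x ⊆ Icc 0 1 := (goodS_sub x).trans Ioo_subset_Icc_self
  -- monotonicity near s0
  have hmono : ∀ w, Good Φ x s0 w → ∃ δ > 0, ∀ s ∈ goodS G x, ∀ t ∈ goodS G x, s0 - δ < s →
      s ≤ t → t < s0 + δ → yF G x t w ≤ yF G x s w := by
    rintro w ⟨δ, hδ, hd⟩
    refine ⟨δ, hδ, fun s hs t ht h1 h2 h3 => ?_⟩
    rcases h2.eq_or_lt with rfl | hst
    · exact le_rfl
    · refine mono_goodS hG hx hs ht hst fun r hr => ?_
      refine hd r ⟨hs.1.1.le.trans hr.1, hr.2.trans ht.1.2.le⟩ ?_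
      rw [abs_lt]
      constructor <;> linarith [hr.1, hr.2]
  have evR : ∀ δ > 0, ∀ᶠ s in 𝓝[goodS G x ∩ Ioi s0] s0, s ∈ goodS G x ∧ s0 < s ∧ s < s0 + δ := by
    intro δ hδ
    filter_upwards [self_mem_nhdsWithin,
      mem_nhdsWithin_of_mem_nhds (Iio_mem_nhds (by linarith : s0 < s0 + δ))] with s h2 h3
    exact ⟨h2.1, h2.2, h3⟩
  have evL : ∀ δ > 0, ∀ᶠ s in 𝓝[goodS G x ∩ Iio s0] s0, s ∈ goodS G x ∧ s < s0 ∧ s0 - δ < s := by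
    intro δ hδ
    filter_upwards [self_mem_nhdsWithin,
      mem_nhdsWithin_of_mem_nhds (Ioi_mem_nhds (by linarith : s0 - δ < s0))] with s h2 h3
    exact ⟨h2.1, h2.2, h3⟩
  obtain ⟨LR, hLR⟩ := limit_right hG hΦ hx hI (by
    intro w hw
    obtain ⟨δ, hδ, hd⟩ := hmono w hw
    obtain ⟨s, hs, hs1, hs2⟩ := (evL δ hδ).exists
    refine ⟨yF G x s w, ?_⟩
    filter_upwards [evR δ hδ] with t ht
    exact hd s hs t ht.1 hs2 (hs1.trans ht.2.1).le ht.2.2)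
  obtain ⟨LL, hLL⟩ := limit_left hG hΦ hx hI (by
    intro w hw
    obtain ⟨δ, hδ, hd⟩ := hmono w hw
    obtain ⟨s, hs, hs1, hs2⟩ := (evR δ hδ).exists
    refine ⟨yF G x s w, ?_⟩
    filter_upwards [evL δ hδ] with t ht
    exact hd t ht.1 s hs ht.2.2 (ht.2.1.trans hs1).le hs2)
  have happ : ∀ {F : Filter ℝ} {L : Evec n →L[ℝ] ℝ} (w : Evec n), Tendsto (yF G x) F (𝓝 L) →
      Tendsto (fun s => yF G x s w) F (𝓝 (L w)) := fun w h =>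
    ((ContinuousLinearMap.apply ℝ ℝ w).continuous.tendsto _).comp h
  have hRL : ∀ w, Good Φ x s0 w → LR w ≤ LL w := by
    intro w hw
    obtain ⟨δ, hδ, hd⟩ := hmono w hw
    refine le_of_tendsto (happ w hLR) ?_
    filter_upwards [evR δ hδ] with t ht
    refine ge_of_tendsto (happ w hLL) ?_
    filter_upwards [evL δ hδ] with s hs
    exact hd s hs.1 t ht.1 hs.2.2 (hs.2.1.trans ht.2.1).le ht.2.2
  have hRS : s0 ∈ goodS G x → ∀ w, Good Φ x s0 w → LR w ≤ yF G x s0 w := by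
    intro hS w hw
    obtain ⟨δ, hδ, hd⟩ := hmono w hw
    refine le_of_tendsto (happ w hLR) ?_
    filter_upwards [evR δ hδ] with t ht
    exact hd s0 hS t ht.1 (by linarith) ht.2.1.le ht.2.2
  have hSL : s0 ∈ goodS G x → ∀ w, Good Φ x s0 w → yF G x s0 w ≤ LL w := by
    intro hS w hw
    obtain ⟨δ, hδ, hd⟩ := hmono w hw
    refine ge_of_tendsto (happ w hLL) ?_
    filter_upwards [evL δ hδ] with t ht
    exact hd t ht.1 s0 hS ht.2.2 ht.2.1.le (by linarith)
  obtain ⟨vR, hvR, hvR'⟩ := deriv_limit hG x hI (inter_subset_left.trans hSI) hLR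
  obtain ⟨vL, hvL, hvL'⟩ := deriv_limit hG x hI (inter_subset_left.trans hSI) hLL
  have dR := xder_right hG x (Ioo_subset_Ico_self hs0) hvR
  have dL := xder_left hG x (Ioo_subset_Ioc_self hs0) hvL
  set N := fderiv ℝ Φ (x.toFun s0) with hN
  have hNd : HasFDerivAt Φ N (x.toFun s0) := (hΦ.differentiable _).hasFDerivAt
  have hNR : Φ (x.toFun s0) = 0 → N vR ≤ 0 := by
    intro h0
    have h1 : HasDerivWithinAt (Φ ∘ x.toFun) (N vR) (Ioi s0) s0 :=
      (hNd.comp_hasDerivWithinAt s0 dR).mono Ioi_subset_Ici_self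
    rw [hasDerivWithinAt_iff_tendsto_slope' (by simp)] at h1
    refine le_of_tendsto h1 ?_
    filter_upwards [Ioo_mem_nhdsGT hs0.2] with r hr
    rw [slope_def_field]
    refine div_nonpos_of_nonpos_of_nonneg ?_ (by linarith [hr.1])
    have := hx.1.1 r ⟨(hs0.1.trans hr.1).le, hr.2.le⟩
    simp only [Function.comp_apply, h0]
    linarith
  have hNL : Φ (x.toFun s0) = 0 → 0 ≤ N vL := by
    intro h0
    have h1 : HasDerivWithinAt (Φ ∘ x.toFun) (N vL) (Iio s0) s0 :=
      (hNd.comp_hasDerivWithinAt s0 dL).mono Iio_subset_Iic_self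
    rw [hasDerivWithinAt_iff_tendsto_slope' (by simp)] at h1
    refine ge_of_tendsto h1 ?_
    filter_upwards [Ioo_mem_nhdsLT hs0.1] with r hr
    rw [slope_def_field]
    refine div_nonneg_of_nonpos ?_ (by linarith [hr.2])
    have := hx.1.1 r ⟨hr.1.le, (hr.2.trans hs0.2).le⟩
    simp only [Function.comp_apply, h0]
    linarith
  have heq : vR = vL := by
    have h1 : (LR - LL) (vR - vL) ≤ 0 := by
      set g := gradient Φ (x.toFun s0) with hg
      have h2 : ∀ ε : ℝ, 0 < ε → (LR - LL) ((vR - vL) - ε • g) ≤ 0 := by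
        intro ε hε
        rw [sub_apply, sub_nonpos]
        refine hRL _ (good_neg hΦ x hI fun h0 => ?_)
        have h3 : 0 < N g := hΦ.grad_pos h0
        change N _ < 0
        rw [map_sub, map_sub, map_smul, smul_eq_mul]
        have := mul_pos hε h3
        linarith [hNR h0, hNL h0]
      have h4 : Tendsto (fun ε : ℝ => (LR - LL) ((vR - vL) - ε • g)) (𝓝[>] 0)
          (𝓝 ((LR - LL) ((vR - vL) - (0:ℝ) • g))) := by
        refine Tendsto.mono_left (Continuous.tendsto ?_ _) nhdsWithin_le_nhds
        fun_prop
      rw [zero_smul, sub_zero] at h4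
      exact le_of_tendsto h4 (by filter_upwards [self_mem_nhdsWithin] with ε hε using h2 ε hε)
    have h5 := hG.dv_mono (x.toFun s0) vR vL
    rw [hvR', hvL', add_sub_add_right_eq_sub] at h5
    have h6 : ‖vR - vL‖ ^ 2 ≤ 0 := by
      by_contra hc
      have := mul_pos hG.alpha_pos (not_le.1 hc)
      linarith
    have h7 : ‖vR - vL‖ = 0 := by
      have := sq_nonneg ‖vR - vL‖
      exact pow_eq_zero_iff two_ne_zero |>.1 (le_antisymm h6 this)
    exact sub_eq_zero.1 (norm_eq_zero.1 h7)
  have hLeq : LR = LL := by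
    have : LR + BF G x s0 = LL + BF G x s0 := by rw [← hvR', ← hvL', heq]
    exact add_right_cancel this
  refine ⟨vR, ?_⟩
  by_cases hS : s0 ∈ goodS G x
  · have hy : yF G x s0 = LR := by
      ext w
      have hy' : ∀ w, Good Φ x s0 w → yF G x s0 w = LR w := fun w hw =>
        le_antisymm (by rw [hLeq]; exact hSL hS w hw) (hRS hS w hw)
      obtain ⟨u, h1, h2⟩ := good_split hΦ x hI w
      have e1 := hy' _ h1
      have e2 := hy' _ h2
      rw [map_add, map_add] at e2
      linarith
    have hv0 : x.deriv s0 = vR := by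
      refine hG.dv_inj (q := x.toFun s0) ?_
      rw [hvR', ← hy, yF, sub_add_cancel, aF]
    have hdec : goodS G x ⊆ (goodS G x ∩ Iio s0) ∪ (goodS G x ∩ Ioi s0) ∪ {s0} := by
      intro s hs
      rcases lt_trichotomy s s0 with h | h | h
      · exact Or.inl (Or.inl ⟨hs, h⟩)
      · exact Or.inr h
      · exact Or.inl (Or.inr ⟨hs, h⟩)
    refine Tendsto.mono_left ?_ (nhdsWithin_mono _ hdec)
    rw [nhdsWithin_union, nhdsWithin_union, nhdsWithin_singleton]
    refine ((heq ▸ hvL).sup hvR).sup ?_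
    rw [← hv0]
    exact tendsto_pure_nhds _ _
  · have hdec : goodS G x ⊆ (goodS G x ∩ Iio s0) ∪ (goodS G x ∩ Ioi s0) := by
      intro s hs
      rcases lt_trichotomy s s0 with h | h | h
      · exact Or.inl ⟨hs, h⟩
      · exact absurd (h ▸ hs) hS
      · exact Or.inr ⟨hs, h⟩
    refine Tendsto.mono_left ?_ (nhdsWithin_mono _ hdec)
    rw [nhdsWithin_union]
    exact (heq ▸ hvL).sup hvR

end Limits


open Topology

section Vel

variable {n : ℕ} {G : Evec n → Evec n → ℝ} {ℓ α : ℝ} {Φ : Evec n → ℝ} {δ₀ : ℝ}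

/-- A continuous representative of the velocity on the open interval. -/
def VRep (G : Evec n → Evec n → ℝ) (x : H1Curve n 0 1) (v : ℝ → Evec n) : Prop :=
  ContinuousOn v (Ioo 0 1) ∧ ∀ s ∈ goodS G x, v s = x.deriv s

/-- The reduced momentum for a continuous representative. -/
def zF (G : Evec n → Evec n → ℝ) (x : H1Curve n 0 1) (v : ℝ → Evec n) (s : ℝ) :
    Evec n →L[ℝ] ℝ :=
  dvCLM G (x.toFun s) (v s) - BF G x s

theorem exists_VRep (hG : IsFinslerEnergy n G ℓ α) (hΦ : IsRegularDomain n Φ δ₀)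
    {x : H1Curve n 0 1} (hx : IsVCritical G Φ x) : ∃ v, VRep G x v := by
  have hcl : Ioo (0:ℝ) 1 ⊆ closure (goodS G x) := by
    intro s hs
    have := goodS_neBot_right hG x (Ioo_subset_Ico_self hs)
    exact closure_mono inter_subset_left (mem_closure_iff_nhdsWithin_neBot.2 this)
  refine ⟨extendFrom (goodS G x) x.deriv, continuousOn_extendFrom hcl
    (fun s hs => interior_limit hG hΦ hx hs), fun s hs => ?_⟩
  obtain ⟨v, hv⟩ := interior_limit hG hΦ hx hs.1
  have h1 := extendFrom_eq (hcl hs.1) hv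
  rw [h1]
  exact tendsto_nhds_unique (hv.mono_left (pure_le_nhdsWithin hs)) (tendsto_pure_nhds x.deriv s)

theorem VRep.eq_ae {x : H1Curve n 0 1} {v : ℝ → Evec n} (hG : IsFinslerEnergy n G ℓ α)
    (hv : VRep G x v) : ∀ᵐ s : ℝ, s ∈ Ioo (0:ℝ) 1 → v s = x.deriv s := by
  filter_upwards [goodS_ae hG x] with s hs hs'
  exact hv.2 s (hs hs')

theorem VRep.contAt {x : H1Curve n 0 1} {v : ℝ → Evec n}
    (hv : VRep G x v) {s : ℝ} (hs : s ∈ Ioo (0:ℝ) 1) : ContinuousAt v s :=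
  hv.1.continuousAt (Ioo_mem_nhds hs.1 hs.2)

theorem H1Curve.contAt (x : H1Curve n 0 1) {s : ℝ} (hs : s ∈ Ioo (0:ℝ) 1) :
    ContinuousAt x.toFun s :=
  x.continuousOn.continuousAt (Icc_mem_nhds hs.1 hs.2)

theorem VRep.deriv_tendsto {x : H1Curve n 0 1} {v : ℝ → Evec n} (hG : IsFinslerEnergy n G ℓ α)
    (hv : VRep G x v) {s : ℝ} (hs : s ∈ Ioo (0:ℝ) 1) :
    Tendsto x.deriv (𝓝 s ⊓ ae volume) (𝓝 (v s)) := by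
  refine ((hv.contAt hs).tendsto.mono_left inf_le_left).congr' ?_
  have h1 : ∀ᶠ r in 𝓝 s ⊓ ae volume, r ∈ Ioo (0:ℝ) 1 := mem_inf_of_left (Ioo_mem_nhds hs.1 hs.2)
  have h2 : ∀ᶠ r in 𝓝 s ⊓ ae volume, r ∈ Ioo (0:ℝ) 1 → v r = x.deriv r :=
    mem_inf_of_right (hv.eq_ae hG)
  filter_upwards [h1, h2] with r hr hr' using hr' hr

theorem VRep.hasDerivAt {x : H1Curve n 0 1} {v : ℝ → Evec n} (hG : IsFinslerEnergy n G ℓ α)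
    (hv : VRep G x v) {s : ℝ} (hs : s ∈ Ioo (0:ℝ) 1) : HasDerivAt x.toFun (v s) s := by
  have hs' : s ∈ Icc (0:ℝ) 1 := Ioo_subset_Icc_self hs
  have h := intervalIntegral.integral_hasDerivAt_of_tendsto_ae_right
    (x.intervalIntegrable' (left_mem_Icc.2 zero_le_one) hs')
    ⟨Icc 0 1, Icc_mem_nhds hs.1 hs.2, x.deriv_integrable.1⟩ (hv.deriv_tendsto hG hs)
  refine (h.const_add (x.toFun 0)).congr_of_eventuallyEq ?_
  filter_upwards [Icc_mem_nhds hs.1 hs.2] with r hr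
  exact x.eq_add_integral r hr

theorem VRep.hasDerivAt_BF {x : H1Curve n 0 1} {v : ℝ → Evec n} (hG : IsFinslerEnergy n G ℓ α)
    (hv : VRep G x v) {s : ℝ} (hs : s ∈ Ioo (0:ℝ) 1) :
    HasDerivAt (BF G x) (dqCLM G (x.toFun s) (v s)) s := by
  have hs' : s ∈ Icc (0:ℝ) 1 := Ioo_subset_Icc_self hs
  have ht : Tendsto (bF G x) (𝓝 s ⊓ ae volume) (𝓝 (dqCLM G (x.toFun s) (v s))) := by
    have := ((x.contAt hs).tendsto.mono_left (inf_le_left (b := ae volume))).prodMk_nhds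
      (hv.deriv_tendsto hG hs)
    exact (hG.continuous_dq.tendsto _).comp this
  exact intervalIntegral.integral_hasDerivAt_of_tendsto_ae_right
    (bF_ii hG x (left_mem_Icc.2 zero_le_one) hs')
    ⟨Icc 0 1, Icc_mem_nhds hs.1 hs.2, (bF_integrableOn hG x).1⟩ ht

theorem VRep.z_cont {x : H1Curve n 0 1} {v : ℝ → Evec n} (hG : IsFinslerEnergy n G ℓ α)
    (hv : VRep G x v) {s : ℝ} (hs : s ∈ Ioo (0:ℝ) 1) : ContinuousAt (zF G x v) s := by
  refine ContinuousAt.sub ?_ (hv.hasDerivAt_BF hG hs).continuousAt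
  exact (hG.continuous_dv.tendsto _).comp ((x.contAt hs).tendsto.prodMk_nhds (hv.contAt hs).tendsto)

theorem VRep.z_eq {x : H1Curve n 0 1} {v : ℝ → Evec n}
    (hv : VRep G x v) {s : ℝ} (hs : s ∈ goodS G x) : zF G x v s = yF G x s := by
  rw [zF, yF, aF, hv.2 s hs]

theorem VRep.z_mono {x : H1Curve n 0 1} {v : ℝ → Evec n} (hG : IsFinslerEnergy n G ℓ α)
    (hx : IsVCritical G Φ x) (hv : VRep G x v) {s t : ℝ} (hs : s ∈ Ioo (0:ℝ) 1)
    (ht : t ∈ Ioo (0:ℝ) 1) (hst : s ≤ t) {w : Evec n} (hw : Adm Φ x s t w) :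
    zF G x v t w ≤ zF G x v s w := by
  rcases hst.eq_or_lt with rfl | hst
  · exact le_rfl
  have nbR := goodS_neBot_right hG x (Ioo_subset_Ico_self hs)
  have nbL := goodS_neBot_left hG x (Ioo_subset_Ioc_self ht)
  have c : ∀ r ∈ Ioo (0:ℝ) 1, Tendsto (fun r => zF G x v r w) (𝓝 r) (𝓝 (zF G x v r w)) :=
    fun r hr => ((ContinuousLinearMap.apply ℝ ℝ w).continuous.tendsto _).comp (hv.z_cont hG hr)
  refine le_of_tendsto ((c t ht).mono_left (nhdsWithin_le_nhds (s := goodS G x ∩ Iio t))) ?_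
  filter_upwards [self_mem_nhdsWithin, mem_nhdsWithin_of_mem_nhds (Ioi_mem_nhds hst)] with t' h1 h2
  refine ge_of_tendsto ((c s hs).mono_left (nhdsWithin_le_nhds (s := goodS G x ∩ Ioi s))) ?_
  filter_upwards [self_mem_nhdsWithin, mem_nhdsWithin_of_mem_nhds (Iio_mem_nhds h2)] with s' h3 h4
  rw [hv.z_eq h1.1, hv.z_eq h3.1]
  exact mono_goodS hG hx h3.1 h1.1 h4 fun r hr =>
    hw r ⟨(le_of_lt h3.2).trans hr.1, hr.2.trans (le_of_lt h1.2)⟩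

/-- At an interior contact point the velocity is tangent. -/
theorem VRep.tangent {x : H1Curve n 0 1} {v : ℝ → Evec n} (hG : IsFinslerEnergy n G ℓ α)
    (hΦ : IsRegularDomain n Φ δ₀) (hx : IsVCritical G Φ x) (hv : VRep G x v) {s : ℝ}
    (hs : s ∈ Ioo (0:ℝ) 1) (h0 : Φ (x.toFun s) = 0) : fderiv ℝ Φ (x.toFun s) (v s) = 0 := by
  have h1 : HasDerivAt (Φ ∘ x.toFun) (fderiv ℝ Φ (x.toFun s) (v s)) s :=
    (hΦ.differentiable _).hasFDerivAt.comp_hasDerivAt s (hv.hasDerivAt hG hs)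
  refine IsLocalMax.hasDerivAt_eq_zero ?_ h1
  filter_upwards [Icc_mem_nhds hs.1 hs.2] with r hr
  simp only [Function.comp_apply, h0]
  exact hx.1.1 r hr

theorem VRep.adm_near {x : H1Curve n 0 1} {v : ℝ → Evec n} (hG : IsFinslerEnergy n G ℓ α)
    (hΦ : IsRegularDomain n Φ δ₀) (hx : IsVCritical G Φ x) (hv : VRep G x v) {s : ℝ}
    (hs : s ∈ Ioo (0:ℝ) 1) : ∃ K ≥ 0, ∃ δ > 0, ∀ t r, |t - s| < δ → |r - s| ≤ |t - s| →
      Φ (x.toFun r) = 0 → |fderiv ℝ Φ (x.toFun r) (v s)| ≤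
        K * |t - s| * fderiv ℝ Φ (x.toFun r) (gradient Φ (x.toFun s)) := by
  by_cases h0 : Φ (x.toFun s) = 0
  · have hN : HasDerivAt (fun r => fderiv ℝ Φ (x.toFun r))
        (fderiv ℝ (fderiv ℝ Φ) (x.toFun s) (v s)) s := by
      have h1 : DifferentiableAt ℝ (fderiv ℝ Φ) (x.toFun s) :=
        ((hΦ.smooth.fderiv_right (m := 1) (by norm_num)).differentiable (by norm_num)) _
      exact h1.hasFDerivAt.comp_hasDerivAt s (hv.hasDerivAt hG hs)
    set g := gradient Φ (x.toFun s) with hg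
    have hNg : 0 < fderiv ℝ Φ (x.toFun s) g := hΦ.grad_pos h0
    set c := fderiv ℝ Φ (x.toFun s) g / 2 with hc
    have hcpos : 0 < c := by positivity
    have e1 : ∀ᶠ r in 𝓝 s, c < fderiv ℝ Φ (x.toFun r) g := by
      have : Tendsto (fun r => fderiv ℝ Φ (x.toFun r) g) (𝓝 s) (𝓝 (fderiv ℝ Φ (x.toFun s) g)) :=
        ((ContinuousLinearMap.apply ℝ ℝ g).continuous.tendsto _).comp hN.continuousAt
      exact this.eventually_const_lt (by rw [hc]; linarith)
    have hb := hN.isBigO_sub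
    obtain ⟨C, hCpos, hC⟩ := hb.exists_pos
    have e2 := hC.bound
    obtain ⟨δ, hδ, hd⟩ := Metric.eventually_nhds_iff.1 (e1.and e2)
    refine ⟨C * ‖v s‖ / c, by positivity, δ, hδ, fun t r ht hr _ => ?_⟩
    obtain ⟨h1, h2⟩ := hd (y := r) (by rw [Real.dist_eq]; linarith)
    have htan := hv.tangent hG hΦ hx hs h0
    have h3 : |fderiv ℝ Φ (x.toFun r) (v s)| ≤ C * |r - s| * ‖v s‖ := by
      have := (fderiv ℝ Φ (x.toFun r) - fderiv ℝ Φ (x.toFun s)).le_opNorm (v s)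
      rw [sub_apply, htan, sub_zero, Real.norm_eq_abs] at this
      refine this.trans ?_
      rw [Real.norm_eq_abs] at h2
      gcongr
    calc |fderiv ℝ Φ (x.toFun r) (v s)| ≤ C * |r - s| * ‖v s‖ := h3
      _ ≤ C * |t - s| * ‖v s‖ := by gcongr
      _ = C * ‖v s‖ / c * |t - s| * c := by field_simp
      _ ≤ _ := by gcongr
  · have h1 : ∀ᶠ r in 𝓝 s, Φ (x.toFun r) ≠ 0 :=
      ((hΦ.continuous.tendsto _).comp (x.contAt hs)).eventually_ne h0
    obtain ⟨δ, hδ, hd⟩ := Metric.eventually_nhds_iff.1 h1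
    refine ⟨0, le_rfl, δ, hδ, fun t r ht hr h => absurd h (hd ?_)⟩
    rw [Real.dist_eq]
    linarith

theorem VRep.z_dini {x : H1Curve n 0 1} {v : ℝ → Evec n} (hG : IsFinslerEnergy n G ℓ α)
    (hΦ : IsRegularDomain n Φ δ₀) (hx : IsVCritical G Φ x) (hv : VRep G x v) {s : ℝ}
    (hs : s ∈ Ioo (0:ℝ) 1) {ε : ℝ} (hε : 0 < ε) :
    ∀ᶠ t in 𝓝 s, -(ε * |t - s|) ≤ (zF G x v t - zF G x v s) (v s) := by
  obtain ⟨K, hK, δ, hδ, h⟩ := hv.adm_near hG hΦ hx hs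
  set g := gradient Φ (x.toFun s) with hg
  have hz : Tendsto (fun t => K * |(zF G x v t - zF G x v s) g|) (𝓝 s) (𝓝 0) := by
    have h1 : Tendsto (fun t => zF G x v t - zF G x v s) (𝓝 s) (𝓝 0) := by
      have := (hv.z_cont hG hs).tendsto.sub_const (zF G x v s)
      rwa [sub_self] at this
    have h2 := (((ContinuousLinearMap.apply ℝ ℝ g).continuous.tendsto _).comp h1).abs.const_mul K
    simpa using h2
  filter_upwards [hz.eventually_lt_const hε, Metric.ball_mem_nhds s hδ,
    Ioo_mem_nhds hs.1 hs.2] with t h1 h2 h3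
  rw [Metric.mem_ball, Real.dist_eq] at h2
  have hfin : K * |(zF G x v t - zF G x v s) g| * |t - s| ≤ ε * |t - s| := by
    gcongr
  rcases le_total s t with hst | hst
  · have hA : Adm Φ x s t (-(v s) - (K * |t - s|) • g) := by
      intro r hr hr0
      have := h t r h2 (by
        rw [abs_of_nonneg (by linarith [hr.1]), abs_of_nonneg (by linarith)]
        linarith [hr.2]) hr0
      rw [map_sub, map_neg, map_smul, smul_eq_mul]
      linarith [neg_abs_le (fderiv ℝ Φ (x.toFun r) (v s))]
    have hm := hv.z_mono hG hx hs h3 hst hA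
    rw [← sub_nonpos, ← sub_apply, map_sub, map_neg, map_smul, smul_eq_mul] at hm
    have h5 : -(K * |t - s| * (zF G x v t - zF G x v s) g) ≤
        K * |(zF G x v t - zF G x v s) g| * |t - s| := by
      have := mul_le_mul_of_nonneg_left (neg_abs_le ((zF G x v t - zF G x v s) g))
        (mul_nonneg hK (abs_nonneg (t - s)))
      linarith
    have h6 : (K * |t - s| * (zF G x v t - zF G x v s) g) ≤
        K * |(zF G x v t - zF G x v s) g| * |t - s| := by
      have := mul_le_mul_of_nonneg_left (le_abs_self ((zF G x v t - zF G x v s) g))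
        (mul_nonneg hK (abs_nonneg (t - s)))
      linarith
    linarith
  · have hA : Adm Φ x t s (v s - (K * |t - s|) • g) := by
      intro r hr hr0
      have := h t r h2 (by
        rw [abs_of_nonpos (by linarith [hr.2]), abs_of_nonpos (by linarith)]
        linarith [hr.1]) hr0
      rw [map_sub, map_smul, smul_eq_mul]
      linarith [le_abs_self (fderiv ℝ Φ (x.toFun r) (v s))]
    have hm := hv.z_mono hG hx h3 hs hst hA
    rw [← sub_nonneg, ← sub_apply, map_sub, map_smul, smul_eq_mul] at hm
    have h5 : -(K * |t - s| * (zF G x v t - zF G x v s) g) ≤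
        K * |(zF G x v t - zF G x v s) g| * |t - s| := by
      have := mul_le_mul_of_nonneg_left (neg_abs_le ((zF G x v t - zF G x v s) g))
        (mul_nonneg hK (abs_nonneg (t - s)))
      linarith
    linarith

theorem VRep.energy_const {x : H1Curve n 0 1} {v : ℝ → Evec n} (hG : IsFinslerEnergy n G ℓ α)
    (hΦ : IsRegularDomain n Φ δ₀) (hx : IsVCritical G Φ x) (hv : VRep G x v) {p q : ℝ}
    (hp : p ∈ Ioo (0:ℝ) 1) (hq : q ∈ Ioo (0:ℝ) 1) (hpq : p ≤ q) :
    G (x.toFun p) (v p) = G (x.toFun q) (v q) := by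
  have hsub : ∀ s ∈ Icc p q, s ∈ Ioo (0:ℝ) 1 := fun s hs =>
    ⟨hp.1.trans_le hs.1, hs.2.trans_lt hq.2⟩
  refine eq_of_dini (f := fun s => G (x.toFun s) (v s)) hpq ?_ ?_
  · intro s hs
    refine ContinuousAt.continuousWithinAt ?_
    exact (hG.continuous.tendsto _).comp
      ((x.contAt (hsub s hs)).tendsto.prodMk_nhds (hv.contAt (hsub s hs)).tendsto)
  · intro s hs ε hε
    have hs' := hsub s hs
    have hR : HasDerivAt (fun t => BF G x t (v s) - G (x.toFun t) (v s)) 0 s := by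
      have h1 : HasDerivAt (fun t => BF G x t (v s)) (dqCLM G (x.toFun s) (v s) (v s)) s :=
        ((ContinuousLinearMap.apply ℝ ℝ (v s)).hasFDerivAt).comp_hasDerivAt s
          (hv.hasDerivAt_BF hG hs')
      have h2 : HasDerivAt (fun t => G (x.toFun t) (v s)) (dqCLM G (x.toFun s) (v s) (v s)) s :=
        (hG.hasFDerivAt_dq (x.toFun s) (v s)).comp_hasDerivAt s (hv.hasDerivAt hG hs')
      have h3 := h1.fun_sub h2
      rwa [sub_self] at h3
    have hR' := (hasDerivAt_iff_isLittleO.1 hR).def (c := ε / 2) (by positivity)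
    filter_upwards [hR', hv.z_dini hG hΦ hx hs' (half_pos hε)] with t h1 h2
    rw [smul_zero, sub_zero, Real.norm_eq_abs, Real.norm_eq_abs, abs_le] at h1
    have h3 := hG.convex (x.toFun t) (v t) (v s)
    have h4 := hG.euler (x.toFun s) (v s)
    simp only [zF, sub_apply] at h2
    linarith [h1.1]

end Vel


open Topology

section Full

variable {n : ℕ} {G : Evec n → Evec n → ℝ} {ℓ α : ℝ} {Φ : Evec n → ℝ} {δ₀ : ℝ}

theorem VRep.energy_const' {x : H1Curve n 0 1} {v : ℝ → Evec n} (hG : IsFinslerEnergy n G ℓ α)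
    (hΦ : IsRegularDomain n Φ δ₀) (hx : IsVCritical G Φ x) (hv : VRep G x v) {p q : ℝ}
    (hp : p ∈ Ioo (0:ℝ) 1) (hq : q ∈ Ioo (0:ℝ) 1) :
    G (x.toFun p) (v p) = G (x.toFun q) (v q) := by
  rcases le_total p q with h | h
  · exact hv.energy_const hG hΦ hx hp hq h
  · exact (hv.energy_const hG hΦ hx hq hp h).symm

theorem VRep.integral_eq {x : H1Curve n 0 1} {v : ℝ → Evec n} (hG : IsFinslerEnergy n G ℓ α)
    (hv : VRep G x v) {E : Type*} [NormedAddCommGroup E] [NormedSpace ℝ E]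
    (F : ℝ → Evec n → E) {t : ℝ} (ht : t ∈ Icc (0:ℝ) 1) :
    ∫ r in (0:ℝ)..t, F r (x.deriv r) = ∫ r in (0:ℝ)..t, F r (v r) := by
  refine intervalIntegral.integral_congr_ae ?_
  have h1 : ∀ᵐ r : ℝ, r ≠ 1 := by simp [ae_iff]
  filter_upwards [hv.eq_ae hG, h1] with r hr h1 hr'
  rw [uIoc_of_le ht.1] at hr'
  rw [hr ⟨hr'.1, lt_of_le_of_ne (hr'.2.trans ht.2) h1⟩]

theorem VRep.energy_pos {x : H1Curve n 0 1} {v : ℝ → Evec n} (hG : IsFinslerEnergy n G ℓ α)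
    (hΦ : IsRegularDomain n Φ δ₀) (hx : IsVCritical G Φ x) (hv : VRep G x v)
    (hnc : ¬ ∃ c : Evec n, ∀ s ∈ Icc (0:ℝ) 1, x.toFun s = c) :
    ∃ E > 0, ∀ s ∈ Ioo (0:ℝ) 1, G (x.toFun s) (v s) = E := by
  have hh : (1/2:ℝ) ∈ Ioo (0:ℝ) 1 := by constructor <;> norm_num
  refine ⟨G (x.toFun (1/2)) (v (1/2)), ?_, fun s hs => hv.energy_const' hG hΦ hx hs hh⟩
  by_contra hE
  refine hnc ⟨x.toFun 0, fun t ht => ?_⟩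
  have hv0 : ∀ s ∈ Ioo (0:ℝ) 1, v s = 0 := by
    intro s hs
    have h1 := hG.lower (x.toFun s) (v s)
    rw [hv.energy_const' hG hΦ hx hs hh] at h1
    by_contra hne
    have h2 : 0 < (1 / ℓ) * ‖v s‖ ^ 2 := by
      have := hG.ell_pos
      positivity
    exact hE (h2.trans_le h1)
  rw [x.eq_add_integral t ht, hv.integral_eq hG (fun _ v => v) ht]
  have h1 : ∫ r in (0:ℝ)..t, v r = ∫ r in (0:ℝ)..t, (0 : Evec n) := by
    refine intervalIntegral.integral_congr_ae ?_
    have h1 : ∀ᵐ r : ℝ, r ≠ 1 := by simp [ae_iff]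
    filter_upwards [h1] with r h1 hr'
    rw [uIoc_of_le ht.1] at hr'
    exact hv0 r ⟨hr'.1, lt_of_le_of_ne (hr'.2.trans ht.2) h1⟩
  rw [h1]
  simp

/-- The velocity has a continuous representative on the closed interval. -/
theorem exists_VFull (hG : IsFinslerEnergy n G ℓ α)
    (hΦ : IsRegularDomain n Φ δ₀) {x : H1Curve n 0 1} (hx : IsVCritical G Φ x)
    (hnc : ¬ ∃ c : Evec n, ∀ s ∈ Icc (0:ℝ) 1, x.toFun s = c) :
    ∃ v, ContinuousOn v (Icc 0 1) ∧ VRep G x v := by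
  obtain ⟨v, hv⟩ := exists_VRep hG hΦ hx
  obtain ⟨E, hE, hEs⟩ := hv.energy_pos hG hΦ hx hnc
  have hell := hG.ell_pos
  have hb1 : ∀ s ∈ goodS G x, ‖x.deriv s‖ ≤ ℓ * E + 1 := by
    intro s hs
    have h1 := hG.lower (x.toFun s) (v s)
    rw [hEs s hs.1, hv.2 s hs, one_div, inv_mul_le_iff₀ hell] at h1
    nlinarith [sq_nonneg (‖x.deriv s‖ - 1), norm_nonneg (x.deriv s)]
  obtain ⟨CB, hCB⟩ := isCompact_Icc.exists_bound_of_continuousOn (BF_continuousOn hG x)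
  have hb2 : ∀ s ∈ goodS G x, ∀ w, |yF G x s w| ≤ (ℓ * (ℓ * E + 1) + CB) * ‖w‖ := by
    intro s hs w
    have h1 := (yF G x s).le_opNorm w
    rw [Real.norm_eq_abs] at h1
    refine h1.trans ?_
    gcongr
    refine (norm_sub_le _ _).trans (add_le_add ((hG.dv_le _ _).trans ?_)
      (hCB s (Ioo_subset_Icc_self hs.1)))
    gcongr
    exact hb1 s hs
  have hI0 : (0:ℝ) ∈ Icc (0:ℝ) 1 := left_mem_Icc.2 zero_le_one
  have hI1 : (1:ℝ) ∈ Icc (0:ℝ) 1 := right_mem_Icc.2 zero_le_one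
  have hSI : goodS G x ⊆ Icc 0 1 := (goodS_sub x).trans Ioo_subset_Icc_self
  have nb0 := goodS_neBot_right hG x (s0 := 0) (left_mem_Ico.2 zero_lt_one)
  have nb1 := goodS_neBot_left hG x (s0 := 1) (right_mem_Ioc.2 zero_lt_one)
  obtain ⟨L0, hL0⟩ := limit_right hG hΦ hx hI0 (fun w _ => ⟨_, by
    filter_upwards [self_mem_nhdsWithin] with s hs
    exact (le_abs_self _).trans (hb2 s hs.1 w)⟩)
  obtain ⟨L1, hL1⟩ := limit_left hG hΦ hx hI1 (fun w _ => ⟨_, by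
    filter_upwards [self_mem_nhdsWithin] with s hs
    exact neg_le_of_abs_le (hb2 s hs.1 w)⟩)
  obtain ⟨v0, hv0, -⟩ := deriv_limit hG x hI0 (inter_subset_left.trans hSI) hL0
  obtain ⟨v1, hv1, -⟩ := deriv_limit hG x hI1 (inter_subset_left.trans hSI) hL1
  rw [inter_eq_left.2 fun s hs => hs.1.1] at hv0 nb0
  rw [inter_eq_left.2 fun s hs => hs.1.2] at hv1 nb1
  have hlim : ∀ s ∈ Icc (0:ℝ) 1, ∃ v, Tendsto x.deriv (𝓝[goodS G x] s) (𝓝 v) := by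
    intro s hs
    rcases hs.1.eq_or_lt with rfl | h0
    · exact ⟨v0, hv0⟩
    rcases hs.2.eq_or_lt with rfl | h1
    · exact ⟨v1, hv1⟩
    exact interior_limit hG hΦ hx ⟨h0, h1⟩
  have hcl : Icc (0:ℝ) 1 ⊆ closure (goodS G x) := by
    intro s hs
    rcases hs.1.eq_or_lt with rfl | h0
    · exact mem_closure_iff_nhdsWithin_neBot.2 nb0
    rcases hs.2.eq_or_lt with rfl | h1
    · exact mem_closure_iff_nhdsWithin_neBot.2 nb1
    have := goodS_neBot_right hG x (s0 := s) ⟨hs.1, h1⟩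
    exact closure_mono inter_subset_left (mem_closure_iff_nhdsWithin_neBot.2 this)
  have hc := continuousOn_extendFrom hcl hlim
  refine ⟨extendFrom (goodS G x) x.deriv, hc, hc.mono Ioo_subset_Icc_self, fun s hs => ?_⟩
  obtain ⟨v, hv⟩ := interior_limit hG hΦ hx hs.1
  rw [extendFrom_eq (hcl (hSI hs)) hv]
  exact tendsto_nhds_unique (hv.mono_left (pure_le_nhdsWithin hs)) (tendsto_pure_nhds x.deriv s)

theorem hasDerivWithinAt_primitive {E : Type*} [NormedAddCommGroup E] [NormedSpace ℝ E]
    [CompleteSpace E] {f : ℝ → E} (hf : ContinuousOn f (Icc 0 1)) {s : ℝ}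
    (hs : s ∈ Icc (0:ℝ) 1) :
    HasDerivWithinAt (fun t => ∫ r in (0:ℝ)..t, f r) (f s) (Icc 0 1) s := by
  have : Fact (s ∈ Icc (0:ℝ) 1) := ⟨hs⟩
  refine intervalIntegral.integral_hasDerivWithinAt_right (s := Icc 0 1) (t := Icc 0 1) ?_ ?_
    (hf s hs)
  · refine ContinuousOn.intervalIntegrable (hf.mono ?_)
    rw [uIcc_of_le hs.1]
    exact Icc_subset_Icc_right hs.2
  · exact hf.stronglyMeasurableAtFilter_nhdsWithin measurableSet_Icc s

variable {x : H1Curve n 0 1} {v : ℝ → Evec n}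

theorem VRep.x_eq (hG : IsFinslerEnergy n G ℓ α) (hv : VRep G x v) {t : ℝ}
    (ht : t ∈ Icc (0:ℝ) 1) : x.toFun t = x.toFun 0 + ∫ r in (0:ℝ)..t, v r := by
  rw [x.eq_add_integral t ht, hv.integral_eq hG (fun _ v => v) ht]

theorem VRep.x_deriv (hG : IsFinslerEnergy n G ℓ α) (hc : ContinuousOn v (Icc 0 1))
    (hv : VRep G x v) {s : ℝ} (hs : s ∈ Icc (0:ℝ) 1) :
    HasDerivWithinAt x.toFun (v s) (Icc 0 1) s :=
  ((hasDerivWithinAt_primitive hc hs).const_add (x.toFun 0)).congr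
    (fun _ ht => hv.x_eq hG ht) (hv.x_eq hG hs)

theorem dq_contOn (hG : IsFinslerEnergy n G ℓ α) (hc : ContinuousOn v (Icc 0 1)) :
    ContinuousOn (fun s => dqCLM G (x.toFun s) (v s)) (Icc 0 1) :=
  hG.continuous_dq.comp_continuousOn (x.continuousOn.prodMk hc)

theorem dv_contOn (hG : IsFinslerEnergy n G ℓ α) (hc : ContinuousOn v (Icc 0 1)) :
    ContinuousOn (fun s => dvCLM G (x.toFun s) (v s)) (Icc 0 1) :=
  hG.continuous_dv.comp_continuousOn (x.continuousOn.prodMk hc)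

theorem VRep.BF_deriv (hG : IsFinslerEnergy n G ℓ α) (hc : ContinuousOn v (Icc 0 1))
    (hv : VRep G x v) {s : ℝ} (hs : s ∈ Icc (0:ℝ) 1) :
    HasDerivWithinAt (BF G x) (dqCLM G (x.toFun s) (v s)) (Icc 0 1) s := by
  have h := hasDerivWithinAt_primitive (dq_contOn (x := x) hG hc) hs
  exact h.congr (fun t ht => hv.integral_eq hG (fun r u => dqCLM G (x.toFun r) u) ht)
    (hv.integral_eq hG (fun r u => dqCLM G (x.toFun r) u) hs)

/-- Euler-Lagrange on an interval without interior contact. -/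
theorem VRep.euler_lagrange (hG : IsFinslerEnergy n G ℓ α) (hx : IsVCritical G Φ x)
    (hc : ContinuousOn v (Icc 0 1))
    (hv : VRep G x v) {b : ℝ} (hb : 0 < b) (hb1 : b ≤ 1)
    (hno : ∀ s ∈ Ioo 0 b, Φ (x.toFun s) < 0) {s : ℝ} (hs : s ∈ Icc 0 b) :
    HasDerivWithinAt (fun t => dvCLM G (x.toFun t) (v t)) (dqCLM G (x.toFun s) (v s))
      (Icc 0 b) s := by
  have hsub : Icc 0 b ⊆ Icc (0:ℝ) 1 := Icc_subset_Icc_right hb1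
  have hcst : ∀ s ∈ Ioo 0 b, ∀ t ∈ Ioo 0 b, s ≤ t → zF G x v t = zF G x v s := by
    intro s hs t ht hst
    have hm : ∀ w, zF G x v t w ≤ zF G x v s w := by
      intro w
      refine hv.z_mono hG hx ⟨hs.1, hs.2.trans_le hb1⟩ ⟨ht.1, ht.2.trans_le hb1⟩ hst ?_
      intro r hr hr0
      exact absurd hr0 (hno r ⟨hs.1.trans_le hr.1, hr.2.trans_lt ht.2⟩).ne
    ext w
    refine le_antisymm (hm w) ?_
    have := hm (-w)
    rw [map_neg, map_neg] at this
    linarith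
  have hmid : b / 2 ∈ Ioo 0 b := ⟨by linarith, by linarith⟩
  have hzc : ContinuousOn (zF G x v) (Icc 0 b) :=
    ((dv_contOn hG hc).sub (BF_continuousOn hG x)).mono hsub
  have heq : EqOn (zF G x v) (fun _ => zF G x v (b / 2)) (Icc 0 b) := by
    refine EqOn.of_subset_closure (s := Ioo 0 b) (fun s hs => ?_) hzc continuousOn_const
      Ioo_subset_Icc_self (by rw [closure_Ioo hb.ne])
    rcases le_total s (b / 2) with h | h
    · exact (hcst s hs _ hmid h).symm
    · exact hcst _ hmid s hs h
  have he : ∀ t ∈ Icc 0 b, dvCLM G (x.toFun t) (v t) = zF G x v (b / 2) + BF G x t := by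
    intro t ht
    have : zF G x v t = zF G x v (b / 2) := heq ht
    rw [← this, zF, sub_add_cancel]
  exact (((hv.BF_deriv hG hc (hsub hs)).mono hsub).const_add (zF G x v (b / 2))).congr he (he s hs)

theorem VRep.dJ_eq (hG : IsFinslerEnergy n G ℓ α) (hv : VRep G x v) (ξ : H1Curve n 0 1) :
    dJ G x ξ = (1 / 2) * ∫ r in (0:ℝ)..1,
      (dqCLM G (x.toFun r) (v r) (ξ.toFun r) + dvCLM G (x.toFun r) (v r) (ξ.deriv r)) := by
  unfold dJ
  rw [hv.integral_eq hG (fun r u => dqCLM G (x.toFun r) u (ξ.toFun r) +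
    dvCLM G (x.toFun r) u (ξ.deriv r)) (right_mem_Icc.2 zero_le_one)]

theorem dJ_integrable (hG : IsFinslerEnergy n G ℓ α) (hc : ContinuousOn v (Icc 0 1))
    (ξ : H1Curve n 0 1) : IntervalIntegrable (fun r => dqCLM G (x.toFun r) (v r) (ξ.toFun r) +
      dvCLM G (x.toFun r) (v r) (ξ.deriv r)) volume 0 1 := by
  refine IntervalIntegrable.add ?_ ?_
  · refine ContinuousOn.intervalIntegrable ?_
    rw [uIcc_of_le zero_le_one]
    exact (dq_contOn hG hc).clm_apply ξ.continuousOn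
  · rw [intervalIntegrable_iff_integrableOn_Icc_of_le zero_le_one]
    obtain ⟨C, hC⟩ := isCompact_Icc.exists_bound_of_continuousOn (dv_contOn (x := x) hG hc)
    refine Integrable.mono' (ξ.deriv_integrable.norm.const_mul C) ?_ ?_
    · exact isBoundedBilinearMap_apply.continuous.comp_aestronglyMeasurable
        (((dv_contOn (x := x) hG hc).aestronglyMeasurable measurableSet_Icc).prodMk
          ξ.deriv_integrable.1)
    · refine (ae_restrict_iff' measurableSet_Icc).2 (Eventually.of_forall fun r hr => ?_)
      exact ((dvCLM G (x.toFun r) (v r)).le_opNorm _).trans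
        (mul_le_mul_of_nonneg_right (hC r hr) (norm_nonneg _))

/-- Orthogonality at the final endpoint when there is no interior contact. -/
theorem VRep.orth_one (hG : IsFinslerEnergy n G ℓ α) (hx : IsVCritical G Φ x)
    (hc : ContinuousOn v (Icc 0 1)) (hv : VRep G x v)
    (hno : ∀ s ∈ Ioo (0:ℝ) 1, Φ (x.toFun s) < 0) {w : Evec n}
    (hw : fderiv ℝ Φ (x.toFun 1) w = 0) : 0 ≤ dvCLM G (x.toFun 1) (v 1) w := by
  set ξ : H1Curve n 0 1 := mkH1 (fun r => r • w) (fun _ => w) (by fun_prop) ∅ countable_empty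
    (fun t _ => by simpa using (hasDerivAt_id' t).smul_const w) measurable_const ‖w‖
    (fun _ _ => le_rfl) with hξ
  have hmem : MemVminus Φ x ξ := by
    refine ⟨?_, ?_, fun s hs h0 => absurd h0 (hno s hs).ne⟩
    · change ⟪gradient Φ (x.toFun 0), (0:ℝ) • w⟫ = 0
      rw [zero_smul, inner_zero_right]
    · change ⟪gradient Φ (x.toFun 1), (1:ℝ) • w⟫ = 0
      rw [one_smul, inner_gradient_left, hw]
  have h0 := hx.2 ξ hmem
  rw [hv.dJ_eq hG] at h0
  have hI := intervalIntegral.integral_eq_sub_of_hasDerivAt_of_le (zero_le_one (α := ℝ))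
    (f := fun r => dvCLM G (x.toFun r) (v r) (r • w))
    (f' := fun r => dqCLM G (x.toFun r) (v r) (ξ.toFun r) +
      dvCLM G (x.toFun r) (v r) (ξ.deriv r))
    ((dv_contOn hG hc).clm_apply (by fun_prop)) (by
      intro r hr
      have h1 : HasDerivAt (fun t => dvCLM G (x.toFun t) (v t)) (dqCLM G (x.toFun r) (v r)) r :=
        (hv.euler_lagrange hG hx hc zero_lt_one le_rfl hno
          (Ioo_subset_Icc_self hr)).hasDerivAt (Icc_mem_nhds hr.1 hr.2)
      have h2 : HasDerivAt (fun t : ℝ => t • w) w r := by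
        simpa using (hasDerivAt_id' r).smul_const w
      exact h1.clm_apply h2) (dJ_integrable hG hc ξ)
  rw [hI] at h0
  simp only [one_smul, zero_smul, map_zero, sub_zero] at h0
  linarith

end Full


open Topology

section Orth

variable {n : ℕ} {G : Evec n → Evec n → ℝ} {ℓ α : ℝ} {Φ : Evec n → ℝ} {δ₀ : ℝ}
variable {x : H1Curve n 0 1} {v : ℝ → Evec n}

theorem VRep.near_zero (hG : IsFinslerEnergy n G ℓ α) (hΦ : IsRegularDomain n Φ δ₀)
    (hx : IsVCritical G Φ x) (hc : ContinuousOn v (Icc 0 1)) (hv : VRep G x v) {w : Evec n}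
    (hw : fderiv ℝ Φ (x.toFun 0) w = 0) : ∃ K ≥ 0, ∃ δ > 0, ∀ r ∈ Icc (0:ℝ) 1, r < δ →
      fderiv ℝ Φ (x.toFun r) w ≤ K * r * fderiv ℝ Φ (x.toFun r) (gradient Φ (x.toFun 0)) := by
  have hI0 : (0:ℝ) ∈ Icc (0:ℝ) 1 := left_mem_Icc.2 zero_le_one
  have hN : HasDerivWithinAt (fun r => fderiv ℝ Φ (x.toFun r))
      (fderiv ℝ (fderiv ℝ Φ) (x.toFun 0) (v 0)) (Icc 0 1) 0 := by
    have h1 : DifferentiableAt ℝ (fderiv ℝ Φ) (x.toFun 0) :=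
      ((hΦ.smooth.fderiv_right (m := 1) (by norm_num)).differentiable (by norm_num)) _
    exact h1.hasFDerivAt.comp_hasDerivWithinAt 0 (hv.x_deriv hG hc hI0)
  set g := gradient Φ (x.toFun 0) with hg
  have hNg : 0 < fderiv ℝ Φ (x.toFun 0) g := hΦ.grad_pos hx.1.2.1
  set c := fderiv ℝ Φ (x.toFun 0) g / 2 with hcd
  have hcpos : 0 < c := by positivity
  have e1 : ∀ᶠ r in 𝓝[Icc 0 1] (0:ℝ), c < fderiv ℝ Φ (x.toFun r) g := by
    have : Tendsto (fun r => fderiv ℝ Φ (x.toFun r) g) (𝓝[Icc 0 1] (0:ℝ))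
        (𝓝 (fderiv ℝ Φ (x.toFun 0) g)) :=
      ((ContinuousLinearMap.apply ℝ ℝ g).continuous.tendsto _).comp hN.continuousWithinAt
    exact this.eventually_const_lt (by rw [hcd]; linarith)
  obtain ⟨C, hCpos, hC⟩ := hN.isBigO_sub.exists_pos
  have e2 := hC.bound
  rw [prod_pure, eventually_map] at e2
  obtain ⟨δ, hδ, hd⟩ := (Metric.nhdsWithin_basis_ball.eventually_iff).1 (e1.and e2)
  refine ⟨C * ‖w‖ / c, by positivity, δ, hδ, fun r hr hrd => ?_⟩
  obtain ⟨h1, h2⟩ := hd (x := r)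
    ⟨by rw [Metric.mem_ball, Real.dist_eq, sub_zero, abs_of_nonneg hr.1]; exact hrd, hr⟩
  have hr0 := hr.1
  have h3 : fderiv ℝ Φ (x.toFun r) w ≤ C * r * ‖w‖ := by
    have := (fderiv ℝ Φ (x.toFun r) - fderiv ℝ Φ (x.toFun 0)).le_opNorm w
    rw [sub_apply, hw, sub_zero, Real.norm_eq_abs] at this
    refine (le_abs_self _).trans (this.trans ?_)
    rw [sub_zero, Real.norm_eq_abs, abs_of_nonneg hr0] at h2
    gcongr
  calc fderiv ℝ Φ (x.toFun r) w ≤ C * r * ‖w‖ := h3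
    _ = C * ‖w‖ / c * r * c := by field_simp
    _ ≤ _ := by gcongr

theorem VRep.orth_zero (hG : IsFinslerEnergy n G ℓ α) (hΦ : IsRegularDomain n Φ δ₀)
    (hx : IsVCritical G Φ x) (hc : ContinuousOn v (Icc 0 1)) (hv : VRep G x v) {w : Evec n}
    (hw : fderiv ℝ Φ (x.toFun 0) w = 0) : dvCLM G (x.toFun 0) (v 0) w ≤ 0 := by
  by_contra hpos
  push Not at hpos
  have hI0 : (0:ℝ) ∈ Icc (0:ℝ) 1 := left_mem_Icc.2 zero_le_one
  obtain ⟨K, hK, δ, hδ, hnear⟩ := hv.near_zero hG hΦ hx hc hw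
  set g := gradient Φ (x.toFun 0) with hg
  obtain ⟨A, hA⟩ := isCompact_Icc.exists_bound_of_continuousOn (dv_contOn (x := x) hG hc)
  obtain ⟨B, hB⟩ := isCompact_Icc.exists_bound_of_continuousOn (dq_contOn (x := x) hG hc)
  have hA0 : 0 ≤ A := (norm_nonneg _).trans (hA 0 hI0)
  have hB0 : 0 ≤ B := (norm_nonneg _).trans (hB 0 hI0)
  set η := dvCLM G (x.toFun 0) (v 0) w with hη
  set M := B * (‖w‖ + K * ‖g‖) + 2 * (K * (A * ‖g‖)) with hM
  have hM0 : 0 ≤ M := by positivity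
  -- choose h
  have e1 : ∀ᶠ r in 𝓝[Icc 0 1] (0:ℝ), η / 2 < dvCLM G (x.toFun r) (v r) w := by
    have : Tendsto (fun r => dvCLM G (x.toFun r) (v r) w) (𝓝[Icc 0 1] (0:ℝ)) (𝓝 η) :=
      ((ContinuousLinearMap.apply ℝ ℝ w).continuous.tendsto _).comp (dv_contOn hG hc 0 hI0)
    exact this.eventually_const_lt (by linarith)
  obtain ⟨δ', hδ', hd'⟩ := (Metric.nhdsWithin_basis_ball.eventually_iff).1 e1
  obtain ⟨h, hh, hhmin⟩ := exists_between
    (show 0 < min (min δ δ') (min 1 (η / (2 * (M + 1)))) from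
      lt_min (lt_min hδ hδ') (lt_min one_pos (by positivity)))
  have hhδ : h < δ := hhmin.trans_le ((min_le_left _ _).trans (min_le_left _ _))
  have hhδ' : h < δ' := hhmin.trans_le ((min_le_left _ _).trans (min_le_right _ _))
  have hh1 : h < 1 := hhmin.trans_le ((min_le_right _ _).trans (min_le_left _ _))
  have hhM : h < η / (2 * (M + 1)) := hhmin.trans_le ((min_le_right _ _).trans (min_le_right _ _))
  rw [lt_div_iff₀ (by positivity)] at hhM
  set f : ℝ → Evec n := fun r => (1 - ramp 0 h r) • (w - (K * r) • g) with hf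
  set f' : ℝ → Evec n := fun r => (1 - ramp 0 h r) • (-(K • g)) +
    (-rampD 0 h r) • (w - (K * r) • g) with hf'
  have hcont : Continuous f := by
    have := ramp_continuous 0 h
    fun_prop
  have hmeas : Measurable f' := by
    have h1 := (ramp_continuous 0 h).measurable
    have h2 := rampD_measurable 0 h
    have h3 : Measurable fun r : ℝ => w - (K * r) • g :=
      (show Continuous fun r : ℝ => w - (K * r) • g by fun_prop).measurable
    exact ((measurable_const.sub h1).smul measurable_const).add (h2.neg.smul h3)
  have hnw : ∀ r ∈ Icc (0:ℝ) 1, ‖w - (K * r) • g‖ ≤ ‖w‖ + K * ‖g‖ := by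
    intro r hr
    refine (norm_sub_le _ _).trans ?_
    rw [norm_smul, Real.norm_eq_abs, abs_of_nonneg (mul_nonneg hK hr.1)]
    have : K * r ≤ K := mul_le_of_le_one_right hK hr.2
    gcongr
  have hr1 : ∀ r, |1 - ramp 0 h r| ≤ 1 := by
    intro r
    rw [abs_le]
    constructor <;> linarith [ramp_nonneg 0 h r, ramp_le_one 0 h r]
  set ξ : H1Curve n 0 1 := mkH1 f f' hcont {0, 0 + h} (toFinite _).countable (by
      intro t ht
      have h1 := (ramp_hasDerivAt hh ht).const_sub 1
      have h2 : HasDerivAt (fun r : ℝ => w - (K * r) • g) (-(K • g)) t := by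
        have := (((hasDerivAt_id' t).const_mul K).smul_const g).const_sub w
        simpa using this
      exact h1.smul h2) hmeas (1 * (K * ‖g‖) + h⁻¹ * (‖w‖ + K * ‖g‖)) (by
      intro r hr
      refine (norm_add_le _ _).trans ?_
      rw [norm_smul, norm_smul, norm_neg, norm_neg, norm_smul, Real.norm_eq_abs, Real.norm_eq_abs,
        Real.norm_eq_abs, abs_of_nonneg hK]
      gcongr
      · exact hr1 r
      · exact rampD_abs_le hh r
      · exact hnw r hr) with hξ
  have hmem : MemVminus Φ x ξ := by
    refine ⟨?_, ?_, ?_⟩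
    · change ⟪gradient Φ (x.toFun 0), f 0⟫ = 0
      simp only [hf]
      rw [ramp_of_le hh le_rfl]
      simp only [sub_zero, one_smul, mul_zero, zero_smul]
      rw [inner_gradient_left, hw]
    · change ⟪gradient Φ (x.toFun 1), f 1⟫ = 0
      simp only [hf]
      rw [ramp_of_ge hh (by linarith)]
      simp
    · intro r hr _
      change ⟪gradient Φ (x.toFun r), f r⟫ ≤ 0
      rw [inner_gradient_left]
      simp only [hf]
      rw [map_smul, smul_eq_mul]
      rcases lt_or_ge r h with hrh | hrh
      · refine mul_nonpos_of_nonneg_of_nonpos (by linarith [ramp_le_one 0 h r]) ?_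
        rw [map_sub, map_smul, smul_eq_mul]
        linarith [hnear r (Ioo_subset_Icc_self hr) (hrh.trans hhδ)]
      · rw [ramp_of_ge hh (by linarith)]
        simp
  have h0 := hx.2 ξ hmem
  rw [hv.dJ_eq hG] at h0
  have hbound : ∫ r in (0:ℝ)..1, (dqCLM G (x.toFun r) (v r) (ξ.toFun r) +
      dvCLM G (x.toFun r) (v r) (ξ.deriv r)) ≤
      ∫ r in (0:ℝ)..1, (Ioo 0 h).indicator (fun _ => M - h⁻¹ * (η / 2)) r * 1 := by
    refine intervalIntegral.integral_mono_on_of_le_Ioo zero_le_one (dJ_integrable hG hc ξ) ?_ ?_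
    · rw [intervalIntegrable_iff_integrableOn_Ioc_of_le zero_le_one]
      simp only [mul_one]
      exact (integrable_const _).indicator measurableSet_Ioo
    intro r hr
    change dqCLM G (x.toFun r) (v r) (f r) + dvCLM G (x.toFun r) (v r) (f' r) ≤ _
    rcases lt_or_ge r h with hrh | hrh
    · have hrI : r ∈ Icc (0:ℝ) 1 := Ioo_subset_Icc_self hr
      have hr0 := hr.1
      rw [indicator_of_mem (show r ∈ Ioo 0 h from ⟨hr.1, hrh⟩), mul_one]
      have eD : rampD 0 h r = h⁻¹ :=
        indicator_of_mem (show r ∈ Ioo 0 (0 + h) from ⟨hr.1, by linarith⟩) _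
      set a := dvCLM G (x.toFun r) (v r) with ha
      set b := dqCLM G (x.toFun r) (v r) with hb
      have haw : η / 2 < a w := hd' ⟨by
        rw [Metric.mem_ball, Real.dist_eq, sub_zero, abs_of_pos hr.1]
        linarith, hrI⟩
      have hag : |a g| ≤ A * ‖g‖ :=
        (a.le_opNorm g).trans (mul_le_mul_of_nonneg_right (hA r hrI) (norm_nonneg _))
      have hbu : |b (w - (K * r) • g)| ≤ B * (‖w‖ + K * ‖g‖) :=
        (b.le_opNorm _).trans (mul_le_mul (hB r hrI) (hnw r hrI) (norm_nonneg _) hB0)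
      have t1 : b (f r) ≤ B * (‖w‖ + K * ‖g‖) := by
        simp only [hf]
        rw [map_smul, smul_eq_mul]
        refine (le_abs_self _).trans ?_
        rw [abs_mul]
        exact (mul_le_of_le_one_left (abs_nonneg _) (hr1 r)).trans hbu
      have t2 : a (f' r) ≤ 2 * (K * (A * ‖g‖)) - h⁻¹ * (η / 2) := by
        simp only [hf', eD]
        rw [map_add, map_smul, map_smul, map_neg, map_smul, map_sub, map_smul]
        simp only [smul_eq_mul]
        have u1 : (1 - ramp 0 h r) * -(K * a g) ≤ K * (A * ‖g‖) := by
          refine (le_abs_self _).trans ?_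
          rw [abs_mul, abs_neg, abs_mul, abs_of_nonneg hK]
          refine (mul_le_of_le_one_left (by positivity) (hr1 r)).trans ?_
          gcongr
        have u2 : h⁻¹ * (η / 2) ≤ h⁻¹ * a w := by gcongr
        have u3 : h⁻¹ * (K * r * a g) ≤ K * (A * ‖g‖) := by
          have e : h⁻¹ * (K * r * a g) = (h⁻¹ * r) * (K * a g) := by ring
          rw [e]
          refine (le_abs_self _).trans ?_
          rw [abs_mul, abs_mul K, abs_of_nonneg hK, abs_of_nonneg (by positivity : 0 ≤ h⁻¹ * r)]
          refine (mul_le_of_le_one_left (by positivity) ?_).trans ?_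
          · rw [inv_mul_le_iff₀ hh]
            linarith
          · gcongr
        linarith
      rw [hM]
      linarith
    · have eD : rampD 0 h r = 0 :=
        indicator_of_notMem (show r ∉ Ioo 0 (0 + h) from fun h' => by linarith [h'.2]) _
      have e1 : ramp 0 h r = 1 := ramp_of_ge hh (by linarith)
      rw [indicator_of_notMem (show r ∉ Ioo 0 h from fun h' => by linarith [h'.2])]
      simp only [hf, hf', eD, e1]
      simp
  rw [integral_indicator_const_mul le_rfl hh.le hh1.le] at hbound
  simp only [intervalIntegral.integral_const, sub_zero, smul_eq_mul, mul_one] at hbound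
  have h3 : (M - h⁻¹ * (η / 2)) * h = M * h - η / 2 := by field_simp
  rw [h3] at hbound
  nlinarith

end Orth

/-- A non-constant `V⁻`-critical curve `x` for `J` on `Mf` has a continuous derivative `v`
and exactly one of the following holds: either some initial piece `x|_{[0,s̄]}` is an
orthogonal–tangent Finsler geodesic chord, or `x` is an orthogonal Finsler geodesic chord. -/
theorem stmt_12 {n : ℕ} (G : Evec n → Evec n → ℝ) (ℓ α : ℝ)
    (hG : IsFinslerEnergy n G ℓ α)
    (Φ : Evec n → ℝ) (δ₀ : ℝ) (hΦ : IsRegularDomain n Φ δ₀)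
    (x : H1Curve n 0 1) (hx : IsVCritical G Φ x)
    (hnc : ¬ ∃ c : Evec n, ∀ s ∈ Icc (0:ℝ) 1, x.toFun s = c) :
    ∃ v : ℝ → Evec n,
      ContinuousOn v (Icc (0:ℝ) 1) ∧
      (∀ t ∈ Icc (0:ℝ) 1, x.toFun t = x.toFun 0 + ∫ s in (0:ℝ)..t, v s) ∧
      Xor'
        -- x restricted to [0,s̄] is an orthogonal–tangent Finsler geodesic chord
        (∃ sb ∈ Ioo (0:ℝ) 1,
          (∀ s ∈ Ioo (0:ℝ) sb, Φ (x.toFun s) < 0) ∧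
          Φ (x.toFun sb) = 0 ∧
          (∀ s ∈ Icc (0:ℝ) sb,
            HasDerivWithinAt (fun t => dvCLM G (x.toFun t) (v t))
              (dqCLM G (x.toFun s) (v s)) (Icc (0:ℝ) sb) s) ∧
          (∀ w : Evec n, ⟪gradient Φ (x.toFun 0), w⟫ = 0 → dvCLM G (x.toFun 0) (v 0) w = 0) ∧
          ⟪gradient Φ (x.toFun sb), v sb⟫ = 0)
        -- x is an orthogonal Finsler geodesic chord
        ((∀ s ∈ Ioo (0:ℝ) 1, Φ (x.toFun s) < 0) ∧
          (∀ s ∈ Icc (0:ℝ) 1,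
            HasDerivWithinAt (fun t => dvCLM G (x.toFun t) (v t))
              (dqCLM G (x.toFun s) (v s)) (Icc (0:ℝ) 1) s) ∧
          (∀ w : Evec n, ⟪gradient Φ (x.toFun 0), w⟫ = 0 → dvCLM G (x.toFun 0) (v 0) w = 0) ∧
          (∀ w : Evec n, ⟪gradient Φ (x.toFun 1), w⟫ = 0 → dvCLM G (x.toFun 1) (v 1) w = 0)) := by
  obtain ⟨v, hc, hv⟩ := exists_VFull hG hΦ hx hnc
  have hI0 : (0:ℝ) ∈ Icc (0:ℝ) 1 := left_mem_Icc.2 zero_le_one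
  refine ⟨v, hc, fun t ht => hv.x_eq hG ht, ?_⟩
  -- orthogonality at the initial endpoint
  have orth0 : ∀ w : Evec n, ⟪gradient Φ (x.toFun 0), w⟫ = 0 →
      dvCLM G (x.toFun 0) (v 0) w = 0 := by
    intro w hw
    rw [inner_gradient_left] at hw
    refine le_antisymm (hv.orth_zero hG hΦ hx hc hw) ?_
    have := hv.orth_zero hG hΦ hx hc (w := -w) (by rw [map_neg, hw, neg_zero])
    rw [map_neg] at this
    linarith
  -- the energy at the initial endpoint is positive
  obtain ⟨E, hE, hEs⟩ := hv.energy_pos hG hΦ hx hnc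
  have hE0 : G (x.toFun 0) (v 0) = E := by
    have : EqOn (fun s => G (x.toFun s) (v s)) (fun _ => E) (Icc 0 1) := by
      refine EqOn.of_subset_closure (s := Ioo 0 1) hEs
        (hG.continuous.comp_continuousOn (x.continuousOn.prodMk hc)) continuousOn_const
        Ioo_subset_Icc_self (by rw [closure_Ioo zero_ne_one])
    exact this hI0
  have hN0 : fderiv ℝ Φ (x.toFun 0) (v 0) ≠ 0 := by
    intro h0
    have h1 := orth0 (v 0) (by rw [inner_gradient_left, h0])
    rw [hG.euler, hE0] at h1
    linarith
  -- no contact right after the initial endpoint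
  have hder : HasDerivWithinAt (Φ ∘ x.toFun) (fderiv ℝ Φ (x.toFun 0) (v 0)) (Icc 0 1) 0 :=
    (hΦ.differentiable _).hasFDerivAt.comp_hasDerivWithinAt 0 (hv.x_deriv hG hc hI0)
  have hev := hder.eventually_ne (c := 0) hN0
  obtain ⟨δ, hδ, hd⟩ := (Metric.nhdsWithin_basis_ball.eventually_iff).1 hev
  have hnear : ∀ s ∈ Ioo (0:ℝ) 1, Φ (x.toFun s) = 0 → δ ≤ s := by
    intro s hs h0
    by_contra hlt
    push Not at hlt
    refine hd (x := s) ⟨?_, Ioo_subset_Icc_self hs, ?_⟩ h0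
    · rw [Metric.mem_ball, Real.dist_eq, sub_zero, abs_of_pos hs.1]
      exact hlt
    · exact hs.1.ne'
  by_cases hcon : ∃ s ∈ Ioo (0:ℝ) 1, Φ (x.toFun s) = 0
  · obtain ⟨z, hz, hz0⟩ := hcon
    refine Or.inl ⟨?_, fun h => (h.1 z hz).ne hz0⟩
    set Z : Set ℝ := {s | s ∈ Ioo (0:ℝ) 1 ∧ Φ (x.toFun s) = 0} with hZ
    have hZne : Z.Nonempty := ⟨z, hz, hz0⟩
    have hZb : BddBelow Z := ⟨0, fun s hs => hs.1.1.le⟩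
    have hclosed : IsClosed (Icc (0:ℝ) 1 ∩ (Φ ∘ x.toFun) ⁻¹' {0}) :=
      (hΦ.continuous.comp_continuousOn x.continuousOn).preimage_isClosed_of_isClosed
        isClosed_Icc isClosed_singleton
    have hmem : sInf Z ∈ Icc (0:ℝ) 1 ∩ (Φ ∘ x.toFun) ⁻¹' {0} := by
      have hsub : Z ⊆ Icc (0:ℝ) 1 ∩ (Φ ∘ x.toFun) ⁻¹' {0} := by
        intro s hs
        exact And.intro (Ioo_subset_Icc_self hs.1) hs.2
      exact closure_minimal hsub hclosed (csInf_mem_closure hZne hZb)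
    have hpos : 0 < sInf Z := hδ.trans_le (le_csInf hZne fun s hs => hnear s hs.1 hs.2)
    have hlt1 : sInf Z < 1 := (csInf_le hZb ⟨hz, hz0⟩).trans_lt hz.2
    have hneg : ∀ s ∈ Ioo (0:ℝ) (sInf Z), Φ (x.toFun s) < 0 := by
      intro s hs
      have hsI : s ∈ Ioo (0:ℝ) 1 := ⟨hs.1, hs.2.trans hlt1⟩
      refine lt_of_le_of_ne (hx.1.1 s (Ioo_subset_Icc_self hsI)) fun h0 => ?_
      exact absurd (csInf_le hZb (show s ∈ Z from ⟨hsI, h0⟩)) (not_le.2 hs.2)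
    have h0 : Φ (x.toFun (sInf Z)) = 0 := hmem.2
    refine ⟨sInf Z, ⟨hpos, hlt1⟩, hneg, h0, fun s hs => ?_, orth0, ?_⟩
    · exact hv.euler_lagrange hG hx hc hpos hlt1.le hneg hs
    · rw [inner_gradient_left]
      exact hv.tangent hG hΦ hx ⟨hpos, hlt1⟩ h0
  · push Not at hcon
    have hneg : ∀ s ∈ Ioo (0:ℝ) 1, Φ (x.toFun s) < 0 := fun s hs =>
      lt_of_le_of_ne (hx.1.1 s (Ioo_subset_Icc_self hs)) (hcon s hs)
    refine Or.inr ⟨⟨hneg, fun s hs => ?_, orth0, fun w hw => ?_⟩, ?_⟩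
    · exact hv.euler_lagrange hG hx hc zero_lt_one le_rfl hneg hs
    · rw [inner_gradient_left] at hw
      refine le_antisymm ?_ (hv.orth_one hG hx hc hneg hw)
      have := hv.orth_one hG hx hc hneg (w := -w) (by rw [map_neg, hw, neg_zero])
      rw [map_neg] at this
      linarith
    · rintro ⟨sb, hsb, -, h0, -⟩
      exact hcon sb hsb h0

end
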